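/- Let φ be a repulsive, tempered potential on ℝ^d with C_φ := ∫_{ℝ^d}(1−e^{−φ(x)})dx > 0. For V > 0 let Λ_V be the axis-parallel cube of volume V centered at the origin, and for real λ ≥ 0 let Z_{Λ_V}(λ) = Σ_{k≥0} (λ^k/k!) ∫_{(Λ_V)^k} ∏_{1≤i<j≤k} e^{−φ(x_i−x_j)} dx_1⋯dx_k, a positive real number. Then there exist an open set Ω ⊂ ℂ containing the real interval [0, e/C_φ) and an analytic function p : Ω → ℂ such that for every real λ ∈ [0, e/C_φ), (1/V)·log Z_{Λ_V}(λ) converges to p(λ) as V → ∞. (Analyticity of the infinite volume pressure, Theorem 1.) -/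

import Mathlib

open MeasureTheory Filter

noncomputable section

/-- Euclidean space ℝ^d. -/
abbrev Euc (d : ℕ) := EuclideanSpace ℝ (Fin d)

/-- `e^{-t}` for `t ∈ [0,∞]`, with the convention `e^{-∞} = 0`. -/
def expNeg (t : ENNReal) : ℝ := if t = ⊤ then 0 else Real.exp (-t.toReal)

/-- The Boltzmann pair weight `∏_{1 ≤ i < j ≤ k} e^{-φ(x_i - x_j)}`. -/
def pairWeight {d : ℕ} (φ : Euc d → ENNReal) (k : ℕ) (x : Fin k → Euc d) : ℝ :=
  ∏ p ∈ Finset.univ.filter (fun p : Fin k × Fin k => p.1 < p.2), expNeg (φ (x p.1 - x p.2))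

/-- The grand canonical partition function `Z_Λ(λ)` at constant real activity `λ`. -/
def Zreal {d : ℕ} (φ : Euc d → ENNReal) (Λ : Set (Euc d)) (lam : ℝ) : ℝ :=
  ∑' k : ℕ, lam ^ k / (Nat.factorial k) *
    ∫ x in Set.univ.pi (fun _ : Fin k => Λ), pairWeight φ k x

/-- The axis-parallel cube of volume `V` centered at the origin in ℝ^d. -/
def cube (d : ℕ) (V : ℝ) : Set (Euc d) := {x | ∀ i, |x i| ≤ V ^ (1 / (d : ℝ)) / 2}

/-- The scalar inequality behind the contraction: it holds exactly up to activity `e`. -/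
lemma exists_contraction_constant {L : ℝ} (hL0 : 0 ≤ L) (hL : L < Real.exp 1) :
    ∃ κ : ℝ, 0 ≤ κ ∧ κ < 1 ∧
      ∀ s : ℝ, 0 ≤ s → L * Real.exp (-s) * (1 + s) ≤ κ * (1 + L * Real.exp (-s)) := by
  have he : 0 < Real.exp 1 := Real.exp_pos 1
  set D : ℝ := L * (Real.exp 1 - 1) + Real.exp 1 with hD
  have he1 : 1 < Real.exp 1 := by
    have := Real.add_one_lt_exp (x := 1) one_ne_zero
    linarith
  have hDpos : 0 < D := by
    have : 0 ≤ L * (Real.exp 1 - 1) := mul_nonneg hL0 (by linarith)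
    linarith
  refine ⟨L * Real.exp 1 / D, by positivity, ?_, ?_⟩
  · rw [div_lt_one hDpos, hD]; nlinarith
  · intro s hs
    have h1 : Real.exp (-s) * (1 + s) ≤ 1 := by
      have := Real.add_one_le_exp s
      have h2 : Real.exp (-s) * Real.exp s = 1 := by rw [← Real.exp_add]; simp
      nlinarith [Real.exp_pos (-s)]
    have h2 : Real.exp 1 * (Real.exp (-s) * s) ≤ 1 := by
      have := Real.add_one_le_exp (s - 1)
      have h2 : Real.exp 1 * Real.exp (-s) * Real.exp (s - 1) = 1 := by
        rw [← Real.exp_add, ← Real.exp_add, ← Real.exp_zero]; congr 1; ring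
      nlinarith [mul_pos he (Real.exp_pos (-s))]
    rw [div_mul_eq_mul_div, le_div_iff₀ hDpos, hD]
    set x := Real.exp (-s)
    have hx : 0 < x := Real.exp_pos _
    set e := Real.exp 1
    have h3 : (L * (e - 1) + e) * (x * (1 + s)) ≤ e * (1 + L * x) := by
      have h4 : (e - L) * (x * (1 + s)) ≤ e - L := by nlinarith
      have h5 : L * (e * (x * s)) ≤ L := by nlinarith
      nlinarith
    nlinarith [mul_le_mul_of_nonneg_left h3 hL0]

lemma abs_sub_le_of_log_le {x y D : ℝ} (hx : 0 < x) (hy : 0 < y)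
    (h : |Real.log x - Real.log y| ≤ D) : y ≤ Real.exp D * x := by
  have h1 : Real.log y ≤ D + Real.log x := by linarith [(abs_le.1 h).1]
  calc y = Real.exp (Real.log y) := (Real.exp_log hy).symm
    _ ≤ Real.exp (D + Real.log x) := Real.exp_le_exp.2 h1
    _ = Real.exp D * x := by rw [Real.exp_add, Real.exp_log hx]

lemma abs_sub_le_mul_of_abs_log_sub_le {x y M D : ℝ} (hx : 0 < x) (hy : 0 < y)
    (hxM : x ≤ M) (hyM : y ≤ M) (h : |Real.log x - Real.log y| ≤ D) : |x - y| ≤ M * D := by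
  have key : ∀ a b : ℝ, 0 < a → 0 < b → a ≤ M → Real.log a - Real.log b ≤ D → a - b ≤ M * D := by
    intro a b ha hb haM hab
    have h1 := Real.log_le_sub_one_of_pos (div_pos hb ha)
    have h2 : a * (b / a) = b := by field_simp
    rw [Real.log_div hb.ne' ha.ne'] at h1
    by_cases hba : b ≤ a
    · have := Real.log_le_log hb hba
      nlinarith
    · have hM : 0 < M := ha.trans_le haM
      have hD : 0 ≤ D := (abs_nonneg _).trans h
      nlinarith
  rw [abs_le] at h
  have h1 := key x y hx hy hxM h.2
  have h2 := key y x hy hx hyM (by linarith [h.1])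
  rw [abs_le]; constructor <;> linarith

/-- One-sided decay of `q ↦ log (1 + L e^{-(q - m)})` against `log q`. -/
lemma log_one_add_exp_decay {L κ m q D : ℝ} (hL0 : 0 ≤ L)
    (hκ : ∀ s : ℝ, 0 ≤ s → L * Real.exp (-s) * (1 + s) ≤ κ * (1 + L * Real.exp (-s)))
    (hm : m ≤ 1) (hq : m ≤ q) (hq0 : 0 ≤ q) (hD : 0 ≤ D) :
    Real.log (1 + L * Real.exp (-(q - m))) - κ * D ≤
      Real.log (1 + L * Real.exp (-(q * Real.exp D - m))) := by
  have hpos : ∀ z : ℝ, 0 < 1 + L * Real.exp z := fun z => by positivity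
  have hder : ∀ t : ℝ, HasDerivAt
      (fun t => Real.log (1 + L * Real.exp (-(q * Real.exp t - m))) + κ * t)
      (L * (Real.exp (-(q * Real.exp t - m)) * (-(q * Real.exp t))) /
        (1 + L * Real.exp (-(q * Real.exp t - m))) + κ * 1) t := by
    intro t
    have h1 : HasDerivAt (fun t => -(q * Real.exp t - m)) (-(q * Real.exp t)) t :=
      (((Real.hasDerivAt_exp t).const_mul q).sub_const m).neg
    exact (((h1.exp.const_mul L).const_add 1).log (hpos _).ne').add
      ((hasDerivAt_id t).const_mul κ)
  have hmono : MonotoneOn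
      (fun t => Real.log (1 + L * Real.exp (-(q * Real.exp t - m))) + κ * t) (Set.Ici 0) := by
    refine monotoneOn_of_deriv_nonneg (convex_Ici 0)
      (fun t _ => (hder t).continuousAt.continuousWithinAt)
      (fun t _ => (hder t).differentiableAt.differentiableWithinAt) ?_
    intro t ht
    rw [interior_Ici] at ht
    rw [(hder t).deriv]
    have h1 : 1 ≤ Real.exp t := Real.one_le_exp (le_of_lt ht)
    have h2 : q ≤ q * Real.exp t := le_mul_of_one_le_right hq0 h1
    have h3 := hκ (q * Real.exp t - m) (by linarith)
    have h4 := hpos (-(q * Real.exp t - m))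
    have h5 : L * (Real.exp (-(q * Real.exp t - m)) * (q * Real.exp t)) /
        (1 + L * Real.exp (-(q * Real.exp t - m))) ≤ κ := by
      rw [div_le_iff₀ h4]
      refine le_trans ?_ h3
      rw [mul_assoc]
      gcongr
      linarith
    have h6 : L * (Real.exp (-(q * Real.exp t - m)) * (-(q * Real.exp t))) =
      -(L * (Real.exp (-(q * Real.exp t - m)) * (q * Real.exp t))) := by ring
    rw [h6, neg_div]
    linarith
  have := hmono (Set.self_mem_Ici) (Set.mem_Ici.2 hD) hD
  simp only [Real.exp_zero, mul_one, mul_zero, add_zero] at this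
  linarith

section kernel

variable {X : Type*} [MeasurableSpace X] {ν : Measure X} {k : X → ℝ} {C lam κ : ℝ}

lemma integrable_mul_of_bdd {g : X → ℝ} (hk : Integrable k ν) (hg : AEStronglyMeasurable g ν)
    {B : ℝ} (hB : ∀ x, |g x| ≤ B) : Integrable (fun x => k x * g x) ν :=
  hk.mul_bdd hg (Eventually.of_forall hB)

lemma integral_mul_mem {g : X → ℝ} (hk0 : ∀ x, 0 ≤ k x) (hk : Integrable k ν)
    (hg : AEStronglyMeasurable g ν) (hg0 : ∀ x, 0 ≤ g x) (hg1 : ∀ x, g x ≤ 1) :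
    0 ≤ ∫ x, k x * g x ∂ν ∧ ∫ x, k x * g x ∂ν ≤ ∫ x, k x ∂ν := by
  refine ⟨integral_nonneg fun x => mul_nonneg (hk0 x) (hg0 x), ?_⟩
  refine integral_mono (integrable_mul_of_bdd hk hg (B := 1) fun x => ?_) hk fun x => ?_
  · rw [abs_of_nonneg (hg0 x)]; exact hg1 x
  · exact mul_le_of_le_one_right (hk0 x) (hg1 x)

/-- The averaging map `g ↦ exp (-λ ∫ k g)` contracts in the coordinate `log (1 + λ C g)`. -/
lemma abs_log_sub_log_le_of_kernel (hlam : 0 ≤ lam) (hC : 0 < C)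
    (hκ : ∀ s : ℝ, 0 ≤ s →
      lam * C * Real.exp (-s) * (1 + s) ≤ κ * (1 + lam * C * Real.exp (-s)))
    (hk0 : ∀ x, 0 ≤ k x) (hk : Integrable k ν) (hkC : ∫ x, k x ∂ν ≤ C)
    {g₁ g₂ : X → ℝ} (hg₁ : AEStronglyMeasurable g₁ ν) (hg₂ : AEStronglyMeasurable g₂ ν)
    (hg₁0 : ∀ x, 0 ≤ g₁ x) (hg₁1 : ∀ x, g₁ x ≤ 1) (hg₂0 : ∀ x, 0 ≤ g₂ x) (hg₂1 : ∀ x, g₂ x ≤ 1)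
    {D : ℝ} (hD : 0 ≤ D)
    (h : ∀ x, |Real.log (1 + lam * C * g₁ x) - Real.log (1 + lam * C * g₂ x)| ≤ D) :
    |Real.log (1 + lam * C * Real.exp (-(lam * ∫ x, k x * g₁ x ∂ν))) -
      Real.log (1 + lam * C * Real.exp (-(lam * ∫ x, k x * g₂ x ∂ν)))| ≤ κ * D := by
  have hL0 : 0 ≤ lam * C := mul_nonneg hlam hC.le
  have hκ0 : 0 ≤ κ := by
    have := hκ 0 le_rfl
    simp only [neg_zero, Real.exp_zero, mul_one, add_zero] at this
    by_contra hneg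
    nlinarith
  set M := ∫ x, k x ∂ν with hM
  have hM0 : 0 ≤ M := integral_nonneg hk0
  have key : ∀ g g' : X → ℝ, AEStronglyMeasurable g ν → AEStronglyMeasurable g' ν →
      (∀ x, 0 ≤ g x) → (∀ x, g x ≤ 1) → (∀ x, 0 ≤ g' x) → (∀ x, g' x ≤ 1) →
      (∀ x, |Real.log (1 + lam * C * g x) - Real.log (1 + lam * C * g' x)| ≤ D) →
      Real.log (1 + lam * C * Real.exp (-(lam * ∫ x, k x * g x ∂ν))) -
      Real.log (1 + lam * C * Real.exp (-(lam * ∫ x, k x * g' x ∂ν))) ≤ κ * D := by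
    intro g g' hg hg' hg0 hg1 hg'0 hg'1 hgg
    have i1 : Integrable (fun x => k x * g x) ν := integrable_mul_of_bdd hk hg (B := 1)
      fun x => by rw [abs_of_nonneg (hg0 x)]; exact hg1 x
    have i2 : Integrable (fun x => k x * g' x) ν := integrable_mul_of_bdd hk hg' (B := 1)
      fun x => by rw [abs_of_nonneg (hg'0 x)]; exact hg'1 x
    have ha := integral_mul_mem hk0 hk hg hg0 hg1
    have hb := integral_mul_mem hk0 hk hg' hg'0 hg'1
    set a := ∫ x, k x * g x ∂ν
    set b := ∫ x, k x * g' x ∂ν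
    have hlb : M + lam * C * b ≤ Real.exp D * (M + lam * C * a) := by
      have e1 : M + lam * C * b = ∫ x, k x * (1 + lam * C * g' x) ∂ν := by
        rw [hM, ← integral_const_mul, ← integral_add hk (i2.const_mul _)]
        congr 1; ext x; ring
      have e2 : Real.exp D * (M + lam * C * a) =
          ∫ x, Real.exp D * (k x * (1 + lam * C * g x)) ∂ν := by
        rw [hM, ← integral_const_mul, ← integral_add hk (i1.const_mul _), ← integral_const_mul]
        congr 1; ext x; ring
      rw [e1, e2]
      refine integral_mono ?_ ?_ fun x => ?_
      · refine (hk.add (i2.const_mul (lam * C))).congr (Eventually.of_forall fun x => ?_)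
        simp only [Pi.add_apply]; ring
      · refine ((hk.add (i1.const_mul (lam * C))).const_mul (Real.exp D)).congr
          (Eventually.of_forall fun x => ?_)
        simp only [Pi.add_apply]; ring
      · have := abs_sub_le_of_log_le (by have := mul_nonneg hL0 (hg0 x); linarith)
          (by have := mul_nonneg hL0 (hg'0 x); linarith) (hgg x)
        calc k x * (1 + lam * C * g' x) ≤ k x * (Real.exp D * (1 + lam * C * g x)) := by
              have := hk0 x; gcongr
          _ = _ := by ring
    set q := M / C + lam * a with hq
    have hm1 : M / C ≤ 1 := (div_le_one hC).2 hkC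
    have hm0 : 0 ≤ M / C := by positivity
    have hla : 0 ≤ lam * a := mul_nonneg hlam ha.1
    have hdec := log_one_add_exp_decay (L := lam * C) (κ := κ) (m := M / C) (q := q) (D := D)
      hL0 hκ hm1 (by linarith) (by linarith) hD
    have hle : lam * b ≤ q * Real.exp D - M / C := by
      have : M / C + lam * b ≤ q * Real.exp D := by
        have e3 : M / C + lam * b = (M + lam * C * b) / C := by field_simp
        have e4 : q * Real.exp D = (Real.exp D * (M + lam * C * a)) / C := by
          rw [hq]; field_simp
        rw [e3, e4]; gcongr
      linarith
    have hqa : q - M / C = lam * a := by rw [hq]; ring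
    rw [hqa] at hdec
    have hmono : Real.log (1 + lam * C * Real.exp (-(q * Real.exp D - M / C))) ≤
        Real.log (1 + lam * C * Real.exp (-(lam * b))) := by
      apply Real.log_le_log (by positivity)
      gcongr
    linarith
  have k1 := key g₁ g₂ hg₁ hg₂ hg₁0 hg₁1 hg₂0 hg₂1 h
  have k2 := key g₂ g₁ hg₂ hg₁ hg₂0 hg₂1 hg₁0 hg₁1 (fun x => by rw [abs_sub_comm]; exact h x)
  rw [abs_le]; constructor <;> linarith

lemma abs_exp_sub_exp_le_of_kernel (hlam : 0 ≤ lam) (hC : 0 < C)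
    (hk0 : ∀ x, 0 ≤ k x) (hk : Integrable k ν) (hkC : ∫ x, k x ∂ν ≤ C)
    {g₁ g₂ : X → ℝ} (hg₁ : AEStronglyMeasurable g₁ ν) (hg₂ : AEStronglyMeasurable g₂ ν)
    (hg₁0 : ∀ x, 0 ≤ g₁ x) (hg₁1 : ∀ x, g₁ x ≤ 1) (hg₂0 : ∀ x, 0 ≤ g₂ x) (hg₂1 : ∀ x, g₂ x ≤ 1)
    {D : ℝ} (hD : 0 ≤ D)
    (h : ∀ x, |Real.log (1 + lam * C * g₁ x) - Real.log (1 + lam * C * g₂ x)| ≤ D) :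
    |Real.exp (-(lam * ∫ x, k x * g₁ x ∂ν)) - Real.exp (-(lam * ∫ x, k x * g₂ x ∂ν))| ≤
      (1 + lam * C) * D := by
  have hL0 : 0 ≤ lam * C := mul_nonneg hlam hC.le
  have i1 : Integrable (fun x => k x * g₁ x) ν := integrable_mul_of_bdd hk hg₁ (B := 1)
    fun x => by rw [abs_of_nonneg (hg₁0 x)]; exact hg₁1 x
  have i2 : Integrable (fun x => k x * g₂ x) ν := integrable_mul_of_bdd hk hg₂ (B := 1)
    fun x => by rw [abs_of_nonneg (hg₂0 x)]; exact hg₂1 x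
  have ha := (integral_mul_mem hk0 hk hg₁ hg₁0 hg₁1).1
  have hb := (integral_mul_mem hk0 hk hg₂ hg₂0 hg₂1).1
  have hpt : ∀ x, |lam * C * (g₁ x - g₂ x)| ≤ (1 + lam * C) * D := by
    intro x
    have p1 := mul_nonneg hL0 (hg₁0 x)
    have p2 := mul_nonneg hL0 (hg₂0 x)
    have := abs_sub_le_mul_of_abs_log_sub_le (M := 1 + lam * C) (by linarith) (by linarith)
      (by nlinarith [hg₁1 x]) (by nlinarith [hg₂1 x]) (h x)
    convert this using 2; ring
  have hdiff : |lam * (∫ x, k x * g₁ x ∂ν) - lam * ∫ x, k x * g₂ x ∂ν| ≤ (1 + lam * C) * D := by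
    have e : C * (lam * (∫ x, k x * g₁ x ∂ν) - lam * ∫ x, k x * g₂ x ∂ν) =
        ∫ x, k x * (lam * C * (g₁ x - g₂ x)) ∂ν := by
      rw [← mul_sub, ← integral_sub i1 i2, ← integral_const_mul, ← integral_const_mul]
      congr 1; ext x; ring
    have hb : |∫ x, k x * (lam * C * (g₁ x - g₂ x)) ∂ν| ≤ C * ((1 + lam * C) * D) := by
      calc |∫ x, k x * (lam * C * (g₁ x - g₂ x)) ∂ν|
          ≤ ∫ x, k x * ((1 + lam * C) * D) ∂ν := by
            rw [← Real.norm_eq_abs]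
            refine norm_integral_le_of_norm_le (hk.mul_const _) (Eventually.of_forall fun x => ?_)
            rw [Real.norm_eq_abs, abs_mul, abs_of_nonneg (hk0 x)]
            exact mul_le_mul_of_nonneg_left (hpt x) (hk0 x)
        _ = (∫ x, k x ∂ν) * ((1 + lam * C) * D) := integral_mul_const _ _
        _ ≤ _ := by gcongr
    rw [← e, abs_mul, abs_of_pos hC] at hb
    exact le_of_mul_le_mul_left hb hC
  refine le_trans ?_ hdiff
  have hlip : ∀ u v : ℝ, 0 ≤ u → u ≤ v → Real.exp (-u) - Real.exp (-v) ≤ v - u := by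
    intro u v hu huv
    have h1 := Real.add_one_le_exp (-(v - u))
    have h2 : Real.exp (-v) = Real.exp (-u) * Real.exp (-(v - u)) := by
      rw [← Real.exp_add]; congr 1; ring
    have h3 : Real.exp (-u) ≤ 1 := Real.exp_le_one_iff.2 (by linarith)
    have h4 := Real.exp_pos (-u)
    rw [h2]; nlinarith
  have hA := mul_nonneg hlam ha
  have hB := mul_nonneg hlam hb
  rcases le_total (lam * ∫ x, k x * g₁ x ∂ν) (lam * ∫ x, k x * g₂ x ∂ν) with hle | hle
  · rw [abs_of_nonneg (sub_nonneg.2 (Real.exp_le_exp.2 (neg_le_neg hle))), abs_sub_comm,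
      abs_of_nonneg (sub_nonneg.2 hle)]
    exact hlip _ _ hA hle
  · rw [abs_sub_comm, abs_of_nonneg (sub_nonneg.2 (Real.exp_le_exp.2 (neg_le_neg hle))),
      abs_of_nonneg (sub_nonneg.2 hle)]
    exact hlip _ _ hB hle

/-- Weighted comparison of two complex averages around a real centre. -/
lemma norm_integral_sub_le_of_kernel
    (hk0 : ∀ x, 0 ≤ k x) (hk : Integrable k ν) (hkC : ∫ x, k x ∂ν ≤ C)
    {γ : X → ℝ} (hγ : AEStronglyMeasurable γ ν) (hγ0 : ∀ x, 0 ≤ γ x) (hγ1 : ∀ x, γ x ≤ 1)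
    {g g' : X → ℂ} (hg : AEStronglyMeasurable g ν) (hg' : AEStronglyMeasurable g' ν)
    {B : ℝ} (hB : ∀ x, ‖g x‖ ≤ B) (hB' : ∀ x, ‖g' x‖ ≤ B) {δ : ℝ} (hδ : 0 ≤ δ)
    (h : ∀ x, ‖g x - g' x‖ ≤ δ * (1 + lam * C * γ x)) :
    ‖(∫ x, (k x : ℂ) * g x ∂ν) - ∫ x, (k x : ℂ) * g' x ∂ν‖ ≤
      δ * (C * (1 + lam * ∫ x, k x * γ x ∂ν)) := by
  have i1 : Integrable (fun x => (k x : ℂ) * g x) ν :=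
    hk.ofReal.mul_bdd hg (Eventually.of_forall hB)
  have i2 : Integrable (fun x => (k x : ℂ) * g' x) ν :=
    hk.ofReal.mul_bdd hg' (Eventually.of_forall hB')
  have i3 : Integrable (fun x => k x * γ x) ν := integrable_mul_of_bdd hk hγ (B := 1)
    fun x => by rw [abs_of_nonneg (hγ0 x)]; exact hγ1 x
  rw [← integral_sub i1 i2]
  calc ‖∫ x, ((k x : ℂ) * g x - (k x : ℂ) * g' x) ∂ν‖
      ≤ ∫ x, δ * (k x + lam * C * (k x * γ x)) ∂ν := by
        refine norm_integral_le_of_norm_le ((hk.add (i3.const_mul _)).const_mul δ)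
          (Eventually.of_forall fun x => ?_)
        rw [← mul_sub, norm_mul, Complex.norm_real, Real.norm_eq_abs, abs_of_nonneg (hk0 x)]
        calc k x * ‖g x - g' x‖ ≤ k x * (δ * (1 + lam * C * γ x)) :=
              mul_le_mul_of_nonneg_left (h x) (hk0 x)
          _ = _ := by ring
    _ = δ * ((∫ x, k x ∂ν) + lam * C * ∫ x, k x * γ x ∂ν) := by
        rw [integral_const_mul, integral_add hk (i3.const_mul _), integral_const_mul]
    _ ≤ δ * (C + lam * C * ∫ x, k x * γ x ∂ν) := by gcongr
    _ = _ := by ring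

end kernel

lemma norm_cexp_sub_cexp_le {x y : ℂ} {M : ℝ} (hx : x.re ≤ M) (hy : y.re ≤ M) :
    ‖Complex.exp x - Complex.exp y‖ ≤ Real.exp M * ‖x - y‖ := by
  refine Convex.norm_image_sub_le_of_norm_hasDerivWithin_le (s := {z : ℂ | z.re ≤ M})
    (f := Complex.exp) (f' := Complex.exp)
    (fun z _ => (Complex.hasDerivAt_exp z).hasDerivWithinAt) (fun z hz => ?_)
    (convex_halfSpace_re_le M) hy hx
  rw [Complex.norm_exp]
  exact Real.exp_le_exp.2 hz

section perturbation

variable {C lam κ κ' ε : ℝ} {z a a' : ℂ} {b η : ℝ}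

lemma exists_perturbation_constants {L : ℝ} (hL0 : 0 ≤ L) (hκ0 : 0 ≤ κ) (hκ1 : κ < 1) :
    ∃ ε κ' : ℝ, 0 < ε ∧ 0 ≤ κ' ∧ κ' < 1 ∧ ε * (1 + L) ≤ 1 ∧
      (1 + κ) / 2 * Real.exp (ε * (2 + L * (1 + L))) ≤ κ' := by
  have h1 : 0 < (1 + κ) / 2 := by linarith
  have h2 : 1 < (3 + κ) / 4 / ((1 + κ) / 2) := by rw [one_lt_div h1]; linarith
  set t := Real.log ((3 + κ) / 4 / ((1 + κ) / 2)) with ht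
  have ht0 : 0 < t := Real.log_pos h2
  have hA : 0 < 2 + L * (1 + L) := by positivity
  refine ⟨min (1 / (1 + L)) (t / (2 + L * (1 + L))), (3 + κ) / 4, by positivity, by linarith,
    by linarith, ?_, ?_⟩
  · rw [← le_div_iff₀ (by positivity)]; exact min_le_left _ _
  · have : min (1 / (1 + L)) (t / (2 + L * (1 + L))) * (2 + L * (1 + L)) ≤ t := by
      rw [← le_div_iff₀ hA]; exact min_le_right _ _
    calc _ ≤ (1 + κ) / 2 * Real.exp t := by gcongr
      _ = _ := by rw [ht, Real.exp_log (by linarith)]; field_simp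

lemma norm_mul_sub_le_of_center (hlam : 0 ≤ lam) (hC : 0 < C) (hb0 : 0 ≤ b) (hbC : b ≤ C)
    (hε0 : 0 ≤ ε) (hε : ε * (1 + lam * C) ≤ 1) (hz : ‖z - lam‖ * C ≤ η)
    (ha : ‖a - b‖ ≤ ε * (C * (1 + lam * b))) :
    ‖z * a - lam * b‖ ≤ 2 * η + lam * C * (1 + lam * b) * ε := by
  have hs : lam * b ≤ lam * C := by gcongr
  have hna : ‖a‖ ≤ 2 * C := by
    have h1 : ‖a‖ ≤ ‖a - b‖ + ‖(b : ℂ)‖ := by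
      simpa using norm_add_le (a - b) (b : ℂ)
    rw [Complex.norm_real, Real.norm_eq_abs, abs_of_nonneg hb0] at h1
    have h2 : ε * (C * (1 + lam * b)) ≤ C := by
      have : ε * (1 + lam * b) ≤ 1 := le_trans (by gcongr) hε
      nlinarith
    linarith
  have e : z * a - lam * b = (z - lam) * a + lam * (a - b) := by ring
  rw [e]
  refine (norm_add_le _ _).trans ?_
  rw [norm_mul, norm_mul, Complex.norm_real, Real.norm_eq_abs, abs_of_nonneg hlam]
  have h1 : ‖z - lam‖ * ‖a‖ ≤ ‖z - lam‖ * (2 * C) := by gcongr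
  have h2 : lam * ‖a - b‖ ≤ lam * (ε * (C * (1 + lam * b))) := by gcongr
  nlinarith

/-- The exponential update keeps a weighted neighbourhood of the real centre. -/
lemma norm_cexp_sub_le_of_center (hlam : 0 ≤ lam) (hC : 0 < C) (hb0 : 0 ≤ b) (hbC : b ≤ C)
    (hκ0 : 0 ≤ κ) (hκ1 : κ < 1)
    (hκ : ∀ s : ℝ, 0 ≤ s →
      lam * C * Real.exp (-s) * (1 + s) ≤ κ * (1 + lam * C * Real.exp (-s)))
    (hε0 : 0 ≤ ε) (hε : ε * (1 + lam * C) ≤ 1) (hκ' : κ' ≤ 1)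
    (hε' : (1 + κ) / 2 * Real.exp (ε * (2 + lam * C * (1 + lam * C))) ≤ κ')
    (hz : ‖z - lam‖ * C ≤ (1 - κ) / 4 * ε)
    (ha : ‖a - b‖ ≤ ε * (C * (1 + lam * b))) :
    ‖Complex.exp (-(z * a)) - Real.exp (-(lam * b))‖ ≤
      ε * (1 + lam * C * Real.exp (-(lam * b))) := by
  have hd := norm_mul_sub_le_of_center hlam hC hb0 hbC hε0 hε hz ha
  have hL0 : 0 ≤ lam * C := by positivity
  have hs0 : 0 ≤ lam * b := by positivity
  have hs : lam * b ≤ lam * C := by gcongr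
  set L := lam * C
  set s := lam * b with hsdef
  set Δ := 2 * ((1 - κ) / 4 * ε) + L * (1 + s) * ε with hΔ
  have hΔ0 : 0 ≤ Δ := (norm_nonneg _).trans hd
  have hΔ1 : Δ ≤ ε * (2 + L * (1 + L)) := by
    have : L * (1 + s) * ε ≤ L * (1 + L) * ε := by gcongr
    nlinarith
  have hre : (-(z * a)).re ≤ -s + Δ := by
    have h1 : ((lam : ℂ) * b - z * a).re ≤ Δ :=
      (Complex.re_le_norm _).trans (by rwa [norm_sub_rev])
    have h2 : ((lam : ℂ) * b).re = s := by rw [← Complex.ofReal_mul, Complex.ofReal_re]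
    rw [Complex.sub_re, h2] at h1
    rw [Complex.neg_re]; linarith
  have h1 := norm_cexp_sub_cexp_le (x := -(z * a)) (y := ((-s : ℝ) : ℂ)) (M := -s + Δ) hre
    (by rw [Complex.ofReal_re]; linarith)
  have h2 : ‖-(z * a) - ((-s : ℝ) : ℂ)‖ ≤ Δ := by
    have : -(z * a) - ((-s : ℝ) : ℂ) = -(z * a - lam * b) := by
      rw [hsdef]; push_cast; ring
    rw [this, norm_neg]; exact hd
  rw [← Complex.ofReal_exp] at h1
  have hk := hκ s hs0
  have hE := Real.exp_pos (-s)
  have hE1 : Real.exp (-s) ≤ 1 := Real.exp_le_one_iff.2 (by linarith)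
  calc _ ≤ Real.exp (-s + Δ) * Δ := h1.trans (by gcongr)
    _ = Real.exp Δ * (Real.exp (-s) * Δ) := by rw [Real.exp_add]; ring
    _ ≤ Real.exp Δ * ((1 + κ) / 2 * (ε * (1 + L * Real.exp (-s)))) := by
        refine mul_le_mul_of_nonneg_left ?_ (Real.exp_pos _).le
        have h3 : Real.exp (-s) * Δ = (1 - κ) / 2 * ε * Real.exp (-s) +
          (L * Real.exp (-s) * (1 + s)) * ε := by rw [hΔ]; ring
        have h4 : (L * Real.exp (-s) * (1 + s)) * ε ≤ κ * (1 + L * Real.exp (-s)) * ε := by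
          gcongr
        have h5 : (1 - κ) / 2 * ε * Real.exp (-s) ≤ (1 - κ) / 2 * ε * (1 + L * Real.exp (-s)) := by
          have : 0 ≤ (1 - κ) / 2 * ε := mul_nonneg (by linarith) hε0
          gcongr
          nlinarith
        rw [h3]; nlinarith
    _ = ((1 + κ) / 2 * Real.exp Δ) * (ε * (1 + L * Real.exp (-s))) := by ring
    _ ≤ 1 * (ε * (1 + L * Real.exp (-s))) := by
        gcongr
        exact le_trans (le_trans (by gcongr) hε') hκ'
    _ = _ := one_mul _

/-- The exponential update contracts in a weighted neighbourhood of the real centre. -/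
lemma norm_cexp_sub_cexp_le_of_center (hlam : 0 ≤ lam) (hC : 0 < C) (hb0 : 0 ≤ b) (hbC : b ≤ C)
    (hκ0 : 0 ≤ κ) (hκ1 : κ < 1)
    (hκ : ∀ s : ℝ, 0 ≤ s →
      lam * C * Real.exp (-s) * (1 + s) ≤ κ * (1 + lam * C * Real.exp (-s)))
    (hε0 : 0 ≤ ε) (hε : ε * (1 + lam * C) ≤ 1)
    (hε' : (1 + κ) / 2 * Real.exp (ε * (2 + lam * C * (1 + lam * C))) ≤ κ')
    (hz : ‖z - lam‖ * C ≤ (1 - κ) / 4 * ε)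
    (ha : ‖a - b‖ ≤ ε * (C * (1 + lam * b)))
    (ha' : ‖a' - b‖ ≤ ε * (C * (1 + lam * b))) {δ : ℝ} (hδ : 0 ≤ δ)
    (haa : ‖a - a'‖ ≤ δ * (C * (1 + lam * b))) :
    ‖Complex.exp (-(z * a)) - Complex.exp (-(z * a'))‖ ≤
      κ' * δ * (1 + lam * C * Real.exp (-(lam * b))) := by
  have hd := norm_mul_sub_le_of_center hlam hC hb0 hbC hε0 hε hz ha
  have hd' := norm_mul_sub_le_of_center hlam hC hb0 hbC hε0 hε hz ha'
  have hL0 : 0 ≤ lam * C := by positivity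
  have hs0 : 0 ≤ lam * b := by positivity
  have hs : lam * b ≤ lam * C := by gcongr
  have hzn : ‖z‖ * C ≤ lam * C + (1 - κ) / 2 := by
    have h1 : ‖z‖ ≤ ‖z - lam‖ + ‖(lam : ℂ)‖ := by simpa using norm_add_le (z - lam) (lam : ℂ)
    rw [Complex.norm_real, Real.norm_eq_abs, abs_of_nonneg hlam] at h1
    have h2 : ε ≤ 1 := by nlinarith
    nlinarith
  set L := lam * C
  set s := lam * b with hsdef
  set Δ := 2 * ((1 - κ) / 4 * ε) + L * (1 + s) * ε with hΔ
  have hΔ0 : 0 ≤ Δ := (norm_nonneg _).trans hd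
  have hΔ1 : Δ ≤ ε * (2 + L * (1 + L)) := by
    have : L * (1 + s) * ε ≤ L * (1 + L) * ε := by gcongr
    nlinarith
  have hre : ∀ c : ℂ, ‖z * c - lam * b‖ ≤ Δ → (-(z * c)).re ≤ -s + Δ := by
    intro c hc
    have h1 : ((lam : ℂ) * b - z * c).re ≤ Δ :=
      (Complex.re_le_norm _).trans (by rwa [norm_sub_rev])
    have h2 : ((lam : ℂ) * b).re = s := by rw [← Complex.ofReal_mul, Complex.ofReal_re]
    rw [Complex.sub_re, h2] at h1
    rw [Complex.neg_re]; linarith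
  have h1 := norm_cexp_sub_cexp_le (hre a hd) (hre a' hd')
  have h2 : ‖-(z * a) - -(z * a')‖ ≤ (L + (1 - κ) / 2) * (δ * (1 + s)) := by
    have : -(z * a) - -(z * a') = -(z * (a - a')) := by ring
    rw [this, norm_neg, norm_mul]
    calc ‖z‖ * ‖a - a'‖ ≤ ‖z‖ * (δ * (C * (1 + s))) := by gcongr
      _ = (‖z‖ * C) * (δ * (1 + s)) := by ring
      _ ≤ _ := by gcongr
  have hk := hκ s hs0
  have hE := Real.exp_pos (-s)
  have hE1 : Real.exp (-s) * (1 + s) ≤ 1 := by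
    have h3 := Real.add_one_le_exp s
    have h4 : Real.exp (-s) * Real.exp s = 1 := by rw [← Real.exp_add]; simp
    nlinarith
  calc _ ≤ Real.exp (-s + Δ) * ((L + (1 - κ) / 2) * (δ * (1 + s))) := h1.trans (by gcongr)
    _ = Real.exp Δ * δ * (L * Real.exp (-s) * (1 + s) +
          (1 - κ) / 2 * (Real.exp (-s) * (1 + s))) := by rw [Real.exp_add]; ring
    _ ≤ Real.exp Δ * δ * ((1 + κ) / 2 * (1 + L * Real.exp (-s))) := by
        gcongr
        have h6 : 0 ≤ L * Real.exp (-s) := by positivity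
        nlinarith
    _ = ((1 + κ) / 2 * Real.exp Δ) * (δ * (1 + L * Real.exp (-s))) := by ring
    _ ≤ κ' * (δ * (1 + L * Real.exp (-s))) := by
        gcongr
        exact le_trans (by gcongr) hε'
    _ = _ := by ring

end perturbation

/-- Differentiation of a dominated family of holomorphic functions under the integral sign. -/
lemma differentiableOn_integral_of_dominated {X : Type*} [MeasurableSpace X] {ν : Measure X}
    {U : Set ℂ} (hU : IsOpen U) {F : ℂ → X → ℂ}
    (hmeas : ∀ z ∈ U, AEStronglyMeasurable (F z) ν)
    (hdiff : ∀ x, DifferentiableOn ℂ (fun z => F z x) U)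
    (hdom : ∀ z₀ ∈ U, ∃ r > 0, ∃ B : X → ℝ, Integrable B ν ∧ Metric.ball z₀ r ⊆ U ∧
      ∀ z ∈ Metric.ball z₀ r, ∀ x, ‖F z x‖ ≤ B x) :
    DifferentiableOn ℂ (fun z => ∫ x, F z x ∂ν) U := by
  intro z₀ hz₀
  obtain ⟨r, hr, B, hB, hsub, hbd⟩ := hdom z₀ hz₀
  have hder : ∀ x, ∀ z ∈ U, HasDerivAt (fun z => F z x) (deriv (fun z => F z x) z) z :=
    fun x z hz => ((hdiff x).differentiableAt (hU.mem_nhds hz)).hasDerivAt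
  have hbd' : ∀ x, ∀ z ∈ Metric.ball z₀ (r / 2), ‖deriv (fun z => F z x) z‖ ≤ B x / (r / 4) := by
    intro x z hz
    rw [Metric.mem_ball] at hz
    have hcl : Metric.closedBall z (r / 4) ⊆ Metric.ball z₀ r := fun w hw => by
      rw [Metric.mem_closedBall] at hw
      rw [Metric.mem_ball]
      linarith [dist_triangle w z z₀]
    refine Complex.norm_deriv_le_of_forall_mem_sphere_norm_le (by positivity)
      (DifferentiableOn.diffContOnCl ?_) fun w hw =>
        hbd w (hcl (Metric.sphere_subset_closedBall hw)) x
    exact (hdiff x).mono ((Metric.closure_ball_subset_closedBall.trans hcl).trans hsub)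
  have hmeas' : AEStronglyMeasurable (fun x => deriv (fun z => F z x) z₀) ν := by
    obtain ⟨u, hu0, hur, hu⟩ : ∃ u : ℕ → ℝ, (∀ n, 0 < u n) ∧ (∀ n, u n < r) ∧
        Tendsto u atTop (nhds 0) := by
      refine ⟨fun n => r / 2 * (1 / ((n : ℝ) + 1)), fun n => by positivity, fun n => ?_, ?_⟩
      · have : 1 / ((n : ℝ) + 1) ≤ 1 := by
          rw [div_le_one (by positivity)]; linarith [(Nat.cast_nonneg n : (0 : ℝ) ≤ n)]
        nlinarith
      · simpa using (tendsto_one_div_add_atTop_nhds_zero_nat (𝕜 := ℝ)).const_mul (r / 2)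
    have hlim : Tendsto (fun n : ℕ => z₀ + (u n : ℂ)) atTop (nhds z₀) := by
      simpa using ((Complex.continuous_ofReal.tendsto 0).comp hu).const_add z₀
    have hne : ∀ n : ℕ, z₀ + (u n : ℂ) ≠ z₀ := fun n => by
      simpa using (hu0 n).ne'
    have hmem : ∀ n : ℕ, z₀ + (u n : ℂ) ∈ U := fun n => hsub <| by
      rw [Metric.mem_ball, dist_self_add_left, Complex.norm_real, Real.norm_eq_abs,
        abs_of_pos (hu0 n)]
      exact hur n
    refine aestronglyMeasurable_of_tendsto_ae atTop
      (f := fun (n : ℕ) x => slope (fun z => F z x) z₀ (z₀ + (u n : ℂ)))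
      (fun n => ?_) (Eventually.of_forall fun x => ?_)
    · simp only [slope_def_field, div_eq_mul_inv]
      exact ((hmeas _ (hmem n)).sub (hmeas _ hz₀)).mul_const _
    · refine (hder x z₀ hz₀).tendsto_slope.comp ?_
      exact tendsto_nhdsWithin_iff.2 ⟨hlim, Eventually.of_forall hne⟩
  have := hasDerivAt_integral_of_dominated_loc_of_deriv_le (𝕜 := ℂ) (F := F) (μ := ν)
    (F' := fun z x => deriv (fun z => F z x) z) (bound := fun x => B x / (r / 4))
    (Metric.ball_mem_nhds z₀ (half_pos hr))
    ((hU.eventually_mem hz₀).mono hmeas)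
    (hB.mono' (hmeas z₀ hz₀) (Eventually.of_forall fun x => hbd z₀ (Metric.mem_ball_self hr) x))
    hmeas' (Eventually.of_forall fun x z hz => hbd' x z hz) (hB.div_const _)
    (Eventually.of_forall fun x z hz => hder x z
      (hsub (Metric.ball_subset_ball (by linarith) hz)))
  exact this.2.differentiableAt.differentiableWithinAt

variable {d : ℕ}

/-- A measurable activity profile with values in `[0, 1]`. -/
structure IsProfile (α : Euc d → ℝ) : Prop where
  measurable : Measurable α
  nonneg : ∀ x, 0 ≤ α x
  le_one : ∀ x, α x ≤ 1

/-- The profile seen from `y` after the interaction `1 - s f` with a particle at the origin. -/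
def reroot (f α : Euc d → ℝ) (s : ℝ) (y : Euc d) : Euc d → ℝ :=
  fun x => α (x + y) * (1 - s * f (x + y))

lemma IsProfile.reroot {f α : Euc d → ℝ} (hf : IsProfile f) (hα : IsProfile α)
    (s : unitInterval) (y : Euc d) : IsProfile (reroot f α s y) := by
  have h : ∀ x, 0 ≤ 1 - (s : ℝ) * f x ∧ 1 - (s : ℝ) * f x ≤ 1 := fun x => by
    have h1 := mul_nonneg s.2.1 (hf.nonneg x)
    have h2 := mul_le_one₀ s.2.2 (hf.nonneg x) (hf.le_one x)
    constructor <;> linarith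
  refine ⟨?_, fun x => mul_nonneg (hα.nonneg _) (h _).1,
    fun x => mul_le_one₀ (hα.le_one _) (h _).1 (h _).2⟩
  have h1 := hα.measurable
  have h2 := hf.measurable
  unfold _root_.reroot
  fun_prop

/-- The kernel against which the density recursion integrates. -/
def stepKernel (f α : Euc d → ℝ) (p : unitInterval × Euc d) : ℝ := α p.2 * f p.2

/-- Iterates of the recursion for the ratio of partition functions at complex activity `z`. -/
def ratioIter (f : Euc d → ℝ) (z : ℂ) : ℕ → (Euc d → ℝ) → ℂ
  | 0, _ => 0
  | n + 1, α => Complex.exp (-(z * ∫ p : unitInterval × Euc d,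
      (stepKernel f α p : ℂ) * ratioIter f z n (reroot f α p.1 p.2)))

/-- Iterates of the recursion for the ratio of partition functions at real activity `lam`. -/
def realRatioIter (f : Euc d → ℝ) (lam : ℝ) : ℕ → (Euc d → ℝ) → ℝ
  | 0, _ => 0
  | n + 1, α => Real.exp (-(lam * ∫ p : unitInterval × Euc d,
      stepKernel f α p * realRatioIter f lam n (reroot f α p.1 p.2)))

lemma ratioIter_ofReal (f : Euc d → ℝ) (lam : ℝ) (n : ℕ) (α : Euc d → ℝ) :
    ratioIter f lam n α = (realRatioIter f lam n α : ℂ) := by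
  induction n generalizing α with
  | zero => simp [ratioIter, realRatioIter]
  | succ n ih =>
    simp only [ratioIter, realRatioIter, ih, ← Complex.ofReal_mul, integral_complex_ofReal,
      ← Complex.ofReal_neg, ← Complex.ofReal_exp]

lemma measurable_reroot_param {P : Type*} [MeasurableSpace P] {f : Euc d → ℝ} (hf : Measurable f)
    {A : P → Euc d → ℝ} (hA : Measurable (Function.uncurry A)) :
    Measurable (Function.uncurry fun (q : P × unitInterval × Euc d) =>
      reroot f (A q.1) q.2.1 q.2.2) := by
  have h1 : Measurable fun w : (P × unitInterval × Euc d) × Euc d => A w.1.1 (w.2 + w.1.2.2) :=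
    hA.comp (g := Function.uncurry A)
      (f := fun w : (P × unitInterval × Euc d) × Euc d => (w.1.1, w.2 + w.1.2.2)) (by fun_prop)
  unfold reroot Function.uncurry
  fun_prop

lemma measurable_ratioIter {f : Euc d → ℝ} (hf : Measurable f) (z : ℂ) (n : ℕ) {P : Type}
    [MeasurableSpace P] {A : P → Euc d → ℝ} (hA : Measurable (Function.uncurry A)) :
    Measurable fun q => ratioIter f z n (A q) := by
  induction n generalizing P with
  | zero => simp only [ratioIter]; exact measurable_const
  | succ n ih =>
    simp only [ratioIter]
    have h1 : Measurable fun w : P × unitInterval × Euc d => A w.1 w.2.2 :=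
      hA.comp (g := Function.uncurry A)
        (f := fun w : P × unitInterval × Euc d => (w.1, w.2.2)) (by fun_prop)
    have h2 := ih (P := P × unitInterval × Euc d)
      (A := fun q => reroot f (A q.1) q.2.1 q.2.2) (measurable_reroot_param hf hA)
    have h3 : StronglyMeasurable (Function.uncurry fun (q : P) (p : unitInterval × Euc d) =>
        (stepKernel f (A q) p : ℂ) * ratioIter f z n (reroot f (A q) p.1 p.2)) := by
      refine Measurable.stronglyMeasurable ?_
      unfold Function.uncurry stepKernel
      fun_prop
    have h4 := h3.integral_prod_right (ν := (volume : Measure (unitInterval × Euc d)))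
    have := h4.measurable
    fun_prop

lemma aestronglyMeasurable_ratioIter_reroot {f α : Euc d → ℝ} (hf : Measurable f)
    (hα : Measurable α) (z : ℂ) (n : ℕ) :
    AEStronglyMeasurable (fun p : unitInterval × Euc d =>
      ratioIter f z n (reroot f α p.1 p.2)) volume := by
  refine (measurable_ratioIter hf z n
    (A := fun p : unitInterval × Euc d => reroot f α p.1 p.2) ?_).aestronglyMeasurable
  unfold reroot Function.uncurry
  fun_prop

lemma aestronglyMeasurable_realRatioIter_reroot {f α : Euc d → ℝ} (hf : Measurable f)
    (hα : Measurable α) (lam : ℝ) (n : ℕ) :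
    AEStronglyMeasurable (fun p : unitInterval × Euc d =>
      realRatioIter f lam n (reroot f α p.1 p.2)) volume := by
  have := (aestronglyMeasurable_ratioIter_reroot hf hα lam n).re
  simpa [ratioIter_ofReal] using this

section bounds

variable {f α : Euc d → ℝ} {C lam κ : ℝ}

lemma stepKernel_nonneg (hf : IsProfile f) (hα : IsProfile α) (p : unitInterval × Euc d) :
    0 ≤ stepKernel f α p := mul_nonneg (hα.nonneg _) (hf.nonneg _)

lemma stepKernel_le (hf : IsProfile f) (hα : IsProfile α) (p : unitInterval × Euc d) :
    stepKernel f α p ≤ f p.2 := mul_le_of_le_one_left (hf.nonneg _) (hα.le_one _)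

lemma integrable_snd (hfi : Integrable f) :
    Integrable (fun p : unitInterval × Euc d => f p.2) := hfi.comp_snd _

lemma measurable_stepKernel (hf : Measurable f) (hα : Measurable α) :
    Measurable (stepKernel f α) := by unfold stepKernel; fun_prop

lemma integrable_stepKernel (hf : IsProfile f) (hfi : Integrable f) (hα : IsProfile α) :
    Integrable (stepKernel f α) := by
  refine (integrable_snd hfi).mono'
    (measurable_stepKernel hf.measurable hα.measurable).aestronglyMeasurable
    (Eventually.of_forall fun p => ?_)
  rw [Real.norm_eq_abs, abs_of_nonneg (stepKernel_nonneg hf hα p)]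
  exact stepKernel_le hf hα p

lemma integral_stepKernel_le (hf : IsProfile f) (hfi : Integrable f) (hα : IsProfile α)
    (hC : ∫ x, f x = C) : ∫ p, stepKernel f α p ≤ C := by
  calc ∫ p, stepKernel f α p ≤ ∫ p : unitInterval × Euc d, f p.2 :=
        integral_mono (integrable_stepKernel hf hfi hα) (integrable_snd hfi) (stepKernel_le hf hα)
    _ = C := by
        rw [Measure.volume_eq_prod, integral_fun_snd, hC]; simp

lemma realRatioIter_mem (hf : IsProfile f) (hlam : 0 ≤ lam) (n : ℕ) (hα : IsProfile α) :
    0 ≤ realRatioIter f lam n α ∧ realRatioIter f lam n α ≤ 1 := by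
  induction n generalizing α with
  | zero => simp [realRatioIter]
  | succ n ih =>
    refine ⟨(Real.exp_pos _).le, Real.exp_le_one_iff.2 ?_⟩
    rw [neg_nonpos]
    exact mul_nonneg hlam (integral_nonneg fun p =>
      mul_nonneg (stepKernel_nonneg hf hα p) (ih (hf.reroot hα p.1 p.2)).1)

/-- A bound for the iterates on the disc of radius `R`. -/
def iterBound (C R : ℝ) : ℕ → ℝ
  | 0 => 0
  | n + 1 => Real.exp (R * (C * iterBound C R n))

lemma iterBound_nonneg (C R : ℝ) (n : ℕ) : 0 ≤ iterBound C R n := by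
  cases n with
  | zero => exact le_rfl
  | succ n => exact (Real.exp_pos _).le

lemma norm_ratioIter_le (hf : IsProfile f) (hfi : Integrable f) (hC : ∫ x, f x = C)
    {R : ℝ} {z : ℂ} (hz : ‖z‖ ≤ R) (n : ℕ) (hα : IsProfile α) :
    ‖ratioIter f z n α‖ ≤ iterBound C R n := by
  induction n generalizing α with
  | zero => simp [ratioIter, iterBound]
  | succ n ih =>
    simp only [ratioIter, iterBound]
    refine (Complex.norm_exp_le_exp_norm _).trans (Real.exp_le_exp.2 ?_)
    rw [norm_neg, norm_mul]
    have hR : 0 ≤ R := (norm_nonneg _).trans hz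
    have hB := iterBound_nonneg C R n
    gcongr
    calc _ ≤ ∫ p : unitInterval × Euc d, stepKernel f α p * iterBound C R n := by
          refine norm_integral_le_of_norm_le ((integrable_stepKernel hf hfi hα).mul_const _)
            (Eventually.of_forall fun p => ?_)
          rw [norm_mul, Complex.norm_real, Real.norm_eq_abs,
            abs_of_nonneg (stepKernel_nonneg hf hα p)]
          exact mul_le_mul_of_nonneg_left (ih (hf.reroot hα p.1 p.2)) (stepKernel_nonneg hf hα p)
      _ = (∫ p, stepKernel f α p) * iterBound C R n := integral_mul_const _ _
      _ ≤ _ := by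
          gcongr
          exact integral_stepKernel_le hf hfi hα hC

lemma differentiable_ratioIter (hf : IsProfile f) (hfi : Integrable f) (n : ℕ)
    (hα : IsProfile α) : Differentiable ℂ fun z => ratioIter f z n α := by
  induction n generalizing α with
  | zero => simp only [ratioIter]; exact differentiable_const _
  | succ n ih =>
    simp only [ratioIter]
    have key : Differentiable ℂ fun z => ∫ p : unitInterval × Euc d,
        (stepKernel f α p : ℂ) * ratioIter f z n (reroot f α p.1 p.2) := by
      rw [← differentiableOn_univ]
      refine differentiableOn_integral_of_dominated isOpen_univ (fun z _ => ?_) (fun p => ?_)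
        (fun z₀ _ => ⟨1, one_pos,
          fun p => stepKernel f α p * iterBound (∫ x, f x) (‖z₀‖ + 1) n,
          (integrable_stepKernel hf hfi hα).mul_const _, Set.subset_univ _, fun z hz p => ?_⟩)
      · exact (Complex.measurable_ofReal.comp
          (measurable_stepKernel hf.measurable hα.measurable)).aestronglyMeasurable.mul
          (aestronglyMeasurable_ratioIter_reroot hf.measurable hα.measurable z n)
      · exact ((ih (hf.reroot hα p.1 p.2)).const_mul _).differentiableOn
      · rw [norm_mul, Complex.norm_real, Real.norm_eq_abs,
          abs_of_nonneg (stepKernel_nonneg hf hα p)]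
        refine mul_le_mul_of_nonneg_left ?_ (stepKernel_nonneg hf hα p)
        refine norm_ratioIter_le hf hfi rfl ?_ n (hf.reroot hα p.1 p.2)
        rw [Metric.mem_ball, dist_eq_norm] at hz
        have : ‖z‖ ≤ ‖z - z₀‖ + ‖z₀‖ := by simpa using norm_add_le (z - z₀) z₀
        linarith
    exact ((differentiable_id.mul key).neg).cexp

/-- The iterates depend continuously on the profile under pointwise convergence. -/
lemma tendsto_ratioIter (hf : IsProfile f) (hfi : Integrable f) (z : ℂ) (n : ℕ) {ι : Type*}
    {l : Filter ι} [l.IsCountablyGenerated] {A : ι → Euc d → ℝ} (hA : ∀ i, IsProfile (A i))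
    (hlim : ∀ x, Tendsto (fun i => A i x) l (nhds (α x))) :
    Tendsto (fun i => ratioIter f z n (A i)) l (nhds (ratioIter f z n α)) := by
  induction n generalizing A α with
  | zero => simp only [ratioIter]; exact tendsto_const_nhds
  | succ n ih =>
    simp only [ratioIter]
    have key : Tendsto (fun i => ∫ p : unitInterval × Euc d,
        (stepKernel f (A i) p : ℂ) * ratioIter f z n (reroot f (A i) p.1 p.2)) l
        (nhds (∫ p : unitInterval × Euc d,
          (stepKernel f α p : ℂ) * ratioIter f z n (reroot f α p.1 p.2))) := by
      refine tendsto_integral_filter_of_dominated_convergence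
        (fun p => f p.2 * iterBound (∫ x, f x) ‖z‖ n) (Eventually.of_forall fun i => ?_)
        (Eventually.of_forall fun i => Eventually.of_forall fun p => ?_)
        ((integrable_snd hfi).mul_const _) (Eventually.of_forall fun p => ?_)
      · exact (Complex.measurable_ofReal.comp
          (measurable_stepKernel hf.measurable (hA i).measurable)).aestronglyMeasurable.mul
          (aestronglyMeasurable_ratioIter_reroot hf.measurable (hA i).measurable z n)
      · rw [norm_mul, Complex.norm_real, Real.norm_eq_abs,
          abs_of_nonneg (stepKernel_nonneg hf (hA i) p)]
        exact mul_le_mul (stepKernel_le hf (hA i) p)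
          (norm_ratioIter_le hf hfi rfl le_rfl n (hf.reroot (hA i) p.1 p.2))
          (norm_nonneg _) (hf.nonneg _)
      · refine Tendsto.mul ((Complex.continuous_ofReal.tendsto _).comp
          ((hlim p.2).mul_const _)) (ih (fun i => hf.reroot (hA i) p.1 p.2) fun x => ?_)
        exact (hlim _).mul_const _
    exact (Complex.continuous_exp.tendsto _).comp ((key.const_mul z).neg)

end bounds

section convergence

variable {d : ℕ} {f α : Euc d → ℝ} {C lam κ : ℝ}

/-- Two orbits of the real recursion approach each other geometrically. -/
lemma abs_sub_le_of_recursion (hf : IsProfile f) (hfi : Integrable f) (hC : ∫ x, f x = C)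
    (hCpos : 0 < C) (hlam : 0 ≤ lam)
    (hκ : ∀ s : ℝ, 0 ≤ s →
      lam * C * Real.exp (-s) * (1 + s) ≤ κ * (1 + lam * C * Real.exp (-s))) (hκ0 : 0 ≤ κ)
    {S : Set (Euc d → ℝ)} (hS : ∀ α ∈ S, IsProfile α)
    (hSr : ∀ α ∈ S, ∀ (s : unitInterval) (y : Euc d), reroot f α s y ∈ S)
    {u v : ℕ → (Euc d → ℝ) → ℝ}
    (hu : ∀ n, ∀ α ∈ S, 0 ≤ u n α ∧ u n α ≤ 1) (hv : ∀ n, ∀ α ∈ S, 0 ≤ v n α ∧ v n α ≤ 1)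
    (hum : ∀ n, ∀ α ∈ S, AEStronglyMeasurable
      (fun p : unitInterval × Euc d => u n (reroot f α p.1 p.2)) volume)
    (hvm : ∀ n, ∀ α ∈ S, AEStronglyMeasurable
      (fun p : unitInterval × Euc d => v n (reroot f α p.1 p.2)) volume)
    (hus : ∀ n, ∀ α ∈ S, u (n + 1) α = Real.exp (-(lam * ∫ p : unitInterval × Euc d,
      stepKernel f α p * u n (reroot f α p.1 p.2))))
    (hvs : ∀ n, ∀ α ∈ S, v (n + 1) α = Real.exp (-(lam * ∫ p : unitInterval × Euc d,
      stepKernel f α p * v n (reroot f α p.1 p.2))))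
    (n : ℕ) (hα : α ∈ S) :
    |u (n + 1) α - v (n + 1) α| ≤ (1 + lam * C) * (κ ^ n * (lam * C)) := by
  have hL0 : 0 ≤ lam * C := by positivity
  have hlog : ∀ n, ∀ α ∈ S, |Real.log (1 + lam * C * u n α) - Real.log (1 + lam * C * v n α)| ≤
      κ ^ n * (lam * C) := by
    intro n
    induction n with
    | zero =>
      intro α hα
      have key : ∀ t : ℝ, 0 ≤ t → t ≤ 1 →
          0 ≤ Real.log (1 + lam * C * t) ∧ Real.log (1 + lam * C * t) ≤ lam * C := by
        intro t h0 h1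
        have h2 : 0 ≤ lam * C * t := by positivity
        refine ⟨Real.log_nonneg (by linarith), ?_⟩
        have := Real.log_le_sub_one_of_pos (show 0 < 1 + lam * C * t by linarith)
        nlinarith
      have h1 := key _ (hu 0 α hα).1 (hu 0 α hα).2
      have h2 := key _ (hv 0 α hα).1 (hv 0 α hα).2
      rw [pow_zero, one_mul, abs_le]
      constructor <;> linarith
    | succ n ih =>
      intro α hα
      rw [hus n α hα, hvs n α hα, pow_succ', mul_assoc κ]
      exact abs_log_sub_log_le_of_kernel hlam hCpos hκ (stepKernel_nonneg hf (hS α hα))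
        (integrable_stepKernel hf hfi (hS α hα)) (integral_stepKernel_le hf hfi (hS α hα) hC)
        (hum n α hα) (hvm n α hα) (fun p => (hu n _ (hSr α hα p.1 p.2)).1)
        (fun p => (hu n _ (hSr α hα p.1 p.2)).2) (fun p => (hv n _ (hSr α hα p.1 p.2)).1)
        (fun p => (hv n _ (hSr α hα p.1 p.2)).2) (by positivity)
        (fun p => ih _ (hSr α hα p.1 p.2))
  rw [hus n α hα, hvs n α hα]
  exact abs_exp_sub_exp_le_of_kernel hlam hCpos (stepKernel_nonneg hf (hS α hα))
    (integrable_stepKernel hf hfi (hS α hα)) (integral_stepKernel_le hf hfi (hS α hα) hC)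
    (hum n α hα) (hvm n α hα) (fun p => (hu n _ (hSr α hα p.1 p.2)).1)
    (fun p => (hu n _ (hSr α hα p.1 p.2)).2) (fun p => (hv n _ (hSr α hα p.1 p.2)).1)
    (fun p => (hv n _ (hSr α hα p.1 p.2)).2) (by positivity)
    (fun p => hlog n _ (hSr α hα p.1 p.2))

lemma abs_realRatioIter_succ_sub_le (hf : IsProfile f) (hfi : Integrable f) (hC : ∫ x, f x = C)
    (hCpos : 0 < C) (hlam : 0 ≤ lam)
    (hκ : ∀ s : ℝ, 0 ≤ s →
      lam * C * Real.exp (-s) * (1 + s) ≤ κ * (1 + lam * C * Real.exp (-s))) (hκ0 : 0 ≤ κ)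
    (n : ℕ) (hα : IsProfile α) :
    |realRatioIter f lam (n + 2) α - realRatioIter f lam (n + 1) α| ≤
      (1 + lam * C) * (κ ^ n * (lam * C)) :=
  abs_sub_le_of_recursion hf hfi hC hCpos hlam hκ hκ0 (S := {α | IsProfile α})
    (u := fun n => realRatioIter f lam (n + 1)) (v := realRatioIter f lam)
    (fun _ h => h) (fun _ h s y => hf.reroot h s y)
    (fun n _ h => realRatioIter_mem hf hlam (n + 1) h) (fun n _ h => realRatioIter_mem hf hlam n h)
    (fun n _ h => aestronglyMeasurable_realRatioIter_reroot hf.measurable h.measurable lam (n + 1))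
    (fun n _ h => aestronglyMeasurable_realRatioIter_reroot hf.measurable h.measurable lam n)
    (fun _ _ _ => rfl) (fun _ _ _ => rfl) n hα

lemma one_add_mul_realRatioIter_mem (hf : IsProfile f) (hCpos : 0 < C) (hlam : 0 ≤ lam) (n : ℕ)
    (hα : IsProfile α) : 1 ≤ 1 + lam * C * realRatioIter f lam n α ∧
      1 + lam * C * realRatioIter f lam n α ≤ 1 + lam * C := by
  have h := realRatioIter_mem hf hlam n hα
  have hL0 : 0 ≤ lam * C := by positivity
  constructor
  · have := mul_nonneg hL0 h.1; linarith
  · have := mul_le_of_le_one_right hL0 h.2; linarith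

/-- The complex orbit stays in a weighted neighbourhood of the real orbit. -/
lemma norm_ratioIter_sub_le (hf : IsProfile f) (hfi : Integrable f) (hC : ∫ x, f x = C)
    (hCpos : 0 < C) (hlam : 0 ≤ lam) (hκ0 : 0 ≤ κ) (hκ1 : κ < 1)
    (hκ : ∀ s : ℝ, 0 ≤ s →
      lam * C * Real.exp (-s) * (1 + s) ≤ κ * (1 + lam * C * Real.exp (-s)))
    {ε κ' : ℝ} (hε0 : 0 ≤ ε) (hε : ε * (1 + lam * C) ≤ 1) (hκ' : κ' ≤ 1)
    (hε' : (1 + κ) / 2 * Real.exp (ε * (2 + lam * C * (1 + lam * C))) ≤ κ')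
    {z : ℂ} (hz : ‖z - lam‖ * C ≤ (1 - κ) / 4 * ε) (n : ℕ) (hα : IsProfile α) :
    ‖ratioIter f z n α - realRatioIter f lam n α‖ ≤
      ε * (1 + lam * C * realRatioIter f lam n α) := by
  induction n generalizing α with
  | zero => simpa [ratioIter, realRatioIter] using hε0
  | succ n ih =>
    have hmem := fun p : unitInterval × Euc d =>
      realRatioIter_mem hf hlam n (hf.reroot hα p.1 p.2)
    have hm := aestronglyMeasurable_realRatioIter_reroot hf.measurable hα.measurable lam n
    have hk0 := stepKernel_nonneg hf hα
    have hki := integrable_stepKernel hf hfi hα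
    have hkC := integral_stepKernel_le hf hfi hα hC
    have hb := integral_mul_mem hk0 hki hm (fun p => (hmem p).1) (fun p => (hmem p).2)
    have hdiff := norm_integral_sub_le_of_kernel (C := C) (lam := lam) hk0 hki hkC hm
      (fun p => (hmem p).1) (fun p => (hmem p).2)
      (aestronglyMeasurable_ratioIter_reroot hf.measurable hα.measurable z n)
      (Complex.continuous_ofReal.comp_aestronglyMeasurable hm) (B := 2)
      (fun p => ?_) (fun p => ?_) hε0 (fun p => ih (hf.reroot hα p.1 p.2))
    · simp only [← Complex.ofReal_mul, integral_complex_ofReal] at hdiff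
      exact norm_cexp_sub_le_of_center hlam hCpos hb.1 (hb.2.trans hkC) hκ0 hκ1 hκ hε0 hε hκ' hε'
        hz hdiff
    · have h1 := ih (hf.reroot hα p.1 p.2)
      have h2 := (one_add_mul_realRatioIter_mem hf hCpos hlam n (hf.reroot hα p.1 p.2)).2
      have h3 := mul_le_mul_of_nonneg_left h2 hε0
      have h4 := norm_add_le (ratioIter f z n (reroot f α p.1 p.2) -
        realRatioIter f lam n (reroot f α p.1 p.2)) (realRatioIter f lam n (reroot f α p.1 p.2))
      rw [sub_add_cancel, Complex.norm_real, Real.norm_eq_abs, abs_of_nonneg (hmem p).1] at h4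
      linarith [(hmem p).2]
    · rw [Complex.norm_real, Real.norm_eq_abs, abs_of_nonneg (hmem p).1]
      linarith [(hmem p).2]

/-- Near a real activity below `e / C` the complex iterates converge geometrically. -/
lemma exists_ball_ratioIter_geometric (hf : IsProfile f) (hfi : Integrable f)
    (hC : ∫ x, f x = C) (hCpos : 0 < C) (hlam : 0 ≤ lam) (hL : lam * C < Real.exp 1) :
    ∃ δ > 0, ∃ κ' : ℝ, 0 ≤ κ' ∧ κ' < 1 ∧ ∃ K : ℝ, ∃ N : ℕ, ∀ z : ℂ, z ∈ Metric.ball (lam : ℂ) δ →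
      ∀ n, ∀ α, IsProfile α →
        ‖ratioIter f z (N + n + 1) α - ratioIter f z (N + n) α‖ ≤ K * κ' ^ n := by
  have hL0 : 0 ≤ lam * C := by positivity
  obtain ⟨κ, hκ0, hκ1, hκ⟩ := exists_contraction_constant hL0 hL
  obtain ⟨ε', κ', hε'0, hκ'0, hκ'1, hε'L, hε'κ⟩ := exists_perturbation_constants hL0 hκ0 hκ1
  set L := lam * C with hLdef
  set ε := ε' / (2 * (1 + L)) with hεdef
  have hε0 : 0 < ε := by positivity
  have hεL : ε * (1 + L) = ε' / 2 := by rw [hεdef]; field_simp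
  have hε'1 : ε' ≤ 1 := by nlinarith
  have hεL1 : ε * (1 + L) ≤ 1 := by linarith
  have hεε' : ε ≤ ε' := by nlinarith
  have hεκ : (1 + κ) / 2 * Real.exp (ε * (2 + L * (1 + L))) ≤ κ' :=
    le_trans (by gcongr) hε'κ
  obtain ⟨M, hM⟩ : ∃ M : ℕ, ∀ n, M ≤ n → (1 + L) * (κ ^ n * L) ≤ ε' / 2 := by
    have h1 : Tendsto (fun n : ℕ => (1 + L) * (κ ^ n * L)) atTop (nhds 0) := by
      simpa using ((tendsto_pow_atTop_nhds_zero_of_lt_one hκ0 hκ1).mul_const L).const_mul (1 + L)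
    exact eventually_atTop.1 ((h1.eventually_lt_const (by positivity)).mono fun _ h => le_of_lt h)
  refine ⟨(1 - κ) / 4 * ε / C, div_pos (mul_pos (by linarith) hε0) hCpos, κ', hκ'0, hκ'1,
    2 * ε' * (1 + L), M + 1, fun z hz => ?_⟩
  have hz' : ‖z - lam‖ * C ≤ (1 - κ) / 4 * ε := by
    rw [Metric.mem_ball, dist_eq_norm, lt_div_iff₀ hCpos] at hz
    exact hz.le
  have hz'' : ‖z - lam‖ * C ≤ (1 - κ) / 4 * ε' :=
    hz'.trans (mul_le_mul_of_nonneg_left hεε' (by linarith))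
  have horb : ∀ n α, IsProfile α → ‖ratioIter f z n α - realRatioIter f lam n α‖ ≤ ε' / 2 := by
    intro n α hα
    refine (norm_ratioIter_sub_le hf hfi hC hCpos hlam hκ0 hκ1 hκ hε0.le hεL1 hκ'1.le
      hεκ hz' n hα).trans ?_
    rw [← hεL]
    exact mul_le_mul_of_nonneg_left (one_add_mul_realRatioIter_mem hf hCpos hlam n hα).2 hε0.le
  have hreal : ∀ n α, IsProfile α →
      ‖(realRatioIter f lam (M + 1 + n + 1) α : ℂ) - realRatioIter f lam (M + 1 + n) α‖ ≤
        ε' / 2 := by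
    intro n α hα
    rw [← Complex.ofReal_sub, Complex.norm_real, Real.norm_eq_abs]
    have := abs_realRatioIter_succ_sub_le hf hfi hC hCpos hlam hκ hκ0 (M + n) hα
    rw [show M + 1 + n + 1 = M + n + 2 by ring, show M + 1 + n = M + n + 1 by ring]
    exact this.trans (hM _ (by omega))
  have hshift : ∀ n α, IsProfile α →
      ‖ratioIter f z (M + 1 + n + 1) α - realRatioIter f lam (M + 1 + n) α‖ ≤ ε' := by
    intro n α hα
    have h1 := horb (M + 1 + n + 1) α hα
    have h2 := hreal n α hα
    have h3 := norm_add_le (ratioIter f z (M + 1 + n + 1) α - realRatioIter f lam (M + 1 + n + 1) α)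
      ((realRatioIter f lam (M + 1 + n + 1) α : ℂ) - realRatioIter f lam (M + 1 + n) α)
    rw [sub_add_sub_cancel] at h3
    linarith
  have hweight := fun n (α : Euc d → ℝ) (hα : IsProfile α) =>
    one_add_mul_realRatioIter_mem hf hCpos hlam n hα
  have hmain : ∀ n, ∀ α, IsProfile α →
      ‖ratioIter f z (M + 1 + n + 1) α - ratioIter f z (M + 1 + n) α‖ ≤
        κ' ^ n * (2 * ε') * (1 + L * realRatioIter f lam (M + 1 + n) α) := by
    intro n
    induction n with
    | zero =>
      intro α hα
      have h1 := hshift 0 α hα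
      have h2 := horb (M + 1 + 0) α hα
      have h3 := norm_sub_le (ratioIter f z (M + 1 + 0 + 1) α - realRatioIter f lam (M + 1 + 0) α)
        (ratioIter f z (M + 1 + 0) α - realRatioIter f lam (M + 1 + 0) α)
      rw [sub_sub_sub_cancel_right] at h3
      have h4 := (hweight (M + 1 + 0) α hα).1
      rw [pow_zero, one_mul]
      nlinarith
    | succ n ih =>
      intro α hα
      have hmem := fun p : unitInterval × Euc d =>
        realRatioIter_mem hf hlam (M + 1 + n) (hf.reroot hα p.1 p.2)
      have hm := aestronglyMeasurable_realRatioIter_reroot hf.measurable hα.measurable lam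
        (M + 1 + n)
      have hm1 := aestronglyMeasurable_ratioIter_reroot hf.measurable hα.measurable z
        (M + 1 + n + 1)
      have hm0 := aestronglyMeasurable_ratioIter_reroot hf.measurable hα.measurable z (M + 1 + n)
      have hmc := Complex.continuous_ofReal.comp_aestronglyMeasurable hm
      have hk0 := stepKernel_nonneg hf hα
      have hki := integrable_stepKernel hf hfi hα
      have hkC := integral_stepKernel_le hf hfi hα hC
      have hb := integral_mul_mem hk0 hki hm (fun p => (hmem p).1) (fun p => (hmem p).2)
      have hbd : ∀ n α, IsProfile α → ‖ratioIter f z n α‖ ≤ 2 := by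
        intro n α hα
        have h1 := horb n α hα
        have h2 := realRatioIter_mem hf hlam n hα
        have h4 := norm_add_le (ratioIter f z n α - realRatioIter f lam n α)
          (realRatioIter f lam n α)
        rw [sub_add_cancel, Complex.norm_real, Real.norm_eq_abs, abs_of_nonneg h2.1] at h4
        linarith
      have hbdc : ∀ p : unitInterval × Euc d,
          ‖(realRatioIter f lam (M + 1 + n) (reroot f α p.1 p.2) : ℂ)‖ ≤ 2 := by
        intro p
        rw [Complex.norm_real, Real.norm_eq_abs, abs_of_nonneg (hmem p).1]
        linarith [(hmem p).2]
      have hw : ∀ (p : unitInterval × Euc d) (x : ℝ), x ≤ ε' →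
          x ≤ ε' * (1 + lam * C * realRatioIter f lam (M + 1 + n) (reroot f α p.1 p.2)) := by
        intro p x hx
        exact hx.trans (le_mul_of_one_le_right hε'0.le
          (hweight _ _ (hf.reroot hα p.1 p.2)).1)
      have d1 := norm_integral_sub_le_of_kernel (C := C) (lam := lam) hk0 hki hkC hm
        (fun p => (hmem p).1) (fun p => (hmem p).2) hm1 hmc (B := 2)
        (fun p => hbd _ _ (hf.reroot hα p.1 p.2)) hbdc hε'0.le
        (fun p => hw p _ (hshift n _ (hf.reroot hα p.1 p.2)))
      have d0 := norm_integral_sub_le_of_kernel (C := C) (lam := lam) hk0 hki hkC hm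
        (fun p => (hmem p).1) (fun p => (hmem p).2) hm0 hmc (B := 2)
        (fun p => hbd _ _ (hf.reroot hα p.1 p.2)) hbdc hε'0.le
        (fun p => hw p _ ((horb _ _ (hf.reroot hα p.1 p.2)).trans (by linarith)))
      have d10 := norm_integral_sub_le_of_kernel (C := C) (lam := lam) hk0 hki hkC hm
        (fun p => (hmem p).1) (fun p => (hmem p).2) hm1 hm0 (B := 2)
        (fun p => hbd _ _ (hf.reroot hα p.1 p.2)) (fun p => hbd _ _ (hf.reroot hα p.1 p.2))
        (δ := κ' ^ n * (2 * ε')) (by positivity) (fun p => ih _ (hf.reroot hα p.1 p.2))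
      simp only [← Complex.ofReal_mul, integral_complex_ofReal] at d1 d0
      have := norm_cexp_sub_cexp_le_of_center hlam hCpos hb.1 (hb.2.trans hkC) hκ0 hκ1 hκ hε'0.le
        hε'L hε'κ hz'' d1 d0 (by positivity) d10
      refine this.trans (le_of_eq ?_)
      change κ' * (κ' ^ n * (2 * ε')) * (1 + L * realRatioIter f lam (M + 1 + (n + 1)) α) = _
      rw [pow_succ']
      ring
  intro n α hα
  refine (hmain n α hα).trans ?_
  calc κ' ^ n * (2 * ε') * (1 + L * realRatioIter f lam (M + 1 + n) α)
      ≤ κ' ^ n * (2 * ε') * (1 + L) := by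
        have := (hweight (M + 1 + n) α hα).2
        gcongr
    _ = _ := by ring

end convergence

section partition

variable {d : ℕ} {e a b : Euc d → ℝ}

/-- The product of the Boltzmann factors `e (x i - x j)` over all pairs `i < j`. -/
def gibbsWeight (e : Euc d → ℝ) (k : ℕ) (x : Fin k → Euc d) : ℝ :=
  ∏ p ∈ Finset.univ.filter (fun p : Fin k × Fin k => p.1 < p.2), e (x p.1 - x p.2)

/-- The `k`-particle term of the partition function with activity function `a`. -/
def gibbsTerm (e a : Euc d → ℝ) (k : ℕ) : ℝ :=
  (k.factorial : ℝ)⁻¹ * ∫ x : Fin k → Euc d, (∏ i, a (x i)) * gibbsWeight e k x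

/-- The partition function with activity function `a`. -/
def gibbsZ (e a : Euc d → ℝ) : ℝ := ∑' k, gibbsTerm e a k

lemma gibbsWeight_nonneg (he : IsProfile e) (k : ℕ) (x : Fin k → Euc d) : 0 ≤ gibbsWeight e k x :=
  Finset.prod_nonneg fun _ _ => he.nonneg _

lemma gibbsWeight_le_one (he : IsProfile e) (k : ℕ) (x : Fin k → Euc d) : gibbsWeight e k x ≤ 1 :=
  Finset.prod_le_one (fun _ _ => he.nonneg _) fun _ _ => he.le_one _

lemma measurable_gibbsWeight (he : Measurable e) (k : ℕ) : Measurable (gibbsWeight e k) := by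
  unfold gibbsWeight
  fun_prop

lemma gibbsWeight_insertNth (hev : ∀ x, e (-x) = e x) {k : ℕ} (j : Fin (k + 1)) (w : Euc d)
    (x : Fin k → Euc d) :
    gibbsWeight e (k + 1) (j.insertNth (α := fun _ => Euc d) w x) =
      (∏ i, e (w - x i)) * gibbsWeight e k x := by
  have hW : ∀ (m : ℕ) (x : Fin m → Euc d), gibbsWeight e m x =
      ∏ i, ∏ l, if i < l then e (x i - x l) else 1 := by
    intro m x
    rw [gibbsWeight, Finset.prod_filter, Fintype.prod_prod_type]
  have hrow : ∀ i, (∏ l, if j.succAbove i < l then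
      e (j.insertNth (α := fun _ => Euc d) w x (j.succAbove i) -
        j.insertNth (α := fun _ => Euc d) w x l) else 1) =
      (if j.succAbove i < j then e (x i - w) else 1) *
        ∏ l, if i < l then e (x i - x l) else 1 := by
    intro i
    rw [Fin.prod_univ_succAbove _ j]
    simp only [Fin.insertNth_apply_same, Fin.insertNth_apply_succAbove,
      (Fin.strictMono_succAbove j).lt_iff_lt]
  rw [hW, hW, Fin.prod_univ_succAbove _ j, Fin.prod_univ_succAbove _ j]
  rw [Finset.prod_congr rfl fun i _ => hrow i]
  simp only [Fin.insertNth_apply_same, Fin.insertNth_apply_succAbove, lt_irrefl, if_false,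
    one_mul, Finset.prod_mul_distrib]
  rw [← mul_assoc, ← Finset.prod_mul_distrib]
  congr 1
  refine Finset.prod_congr rfl fun i _ => ?_
  rcases lt_or_gt_of_ne (Fin.succAbove_ne j i) with h | h
  · rw [if_neg h.not_gt, if_pos h, one_mul, ← hev, neg_sub]
  · rw [if_pos h, if_neg h.not_gt, mul_one]

lemma integrable_prod_comp (ha : Integrable a) (k : ℕ) :
    Integrable (fun x : Fin k → Euc d => ∏ i, a (x i)) :=
  Integrable.fintype_prod (f := fun _ : Fin k => a) fun _ => ha

lemma integrable_prod_mul_gibbsWeight (he : IsProfile e) (ha : Integrable a) (k : ℕ) :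
    Integrable (fun x : Fin k → Euc d => (∏ i, a (x i)) * gibbsWeight e k x) := by
  refine (integrable_prod_comp ha k).mul_bdd (c := 1)
    (measurable_gibbsWeight he.measurable k).aestronglyMeasurable (Eventually.of_forall fun x => ?_)
  rw [Real.norm_eq_abs, abs_of_nonneg (gibbsWeight_nonneg he k x)]
  exact gibbsWeight_le_one he k x

lemma abs_gibbsTerm_le (he : IsProfile e) (ha : Integrable a) (k : ℕ) :
    |gibbsTerm e a k| ≤ (∫ x, |a x|) ^ k / k.factorial := by
  rw [gibbsTerm, abs_mul, abs_of_nonneg (by positivity : (0 : ℝ) ≤ (k.factorial : ℝ)⁻¹),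
    div_eq_inv_mul]
  gcongr
  calc |∫ x : Fin k → Euc d, (∏ i, a (x i)) * gibbsWeight e k x|
      ≤ ∫ x : Fin k → Euc d, ∏ i, |a (x i)| := by
        rw [← Real.norm_eq_abs]
        refine norm_integral_le_of_norm_le (integrable_prod_comp ha.abs k)
          (Eventually.of_forall fun x => ?_)
        rw [Real.norm_eq_abs, abs_mul, Finset.abs_prod, abs_of_nonneg (gibbsWeight_nonneg he k x)]
        exact mul_le_of_le_one_right (by positivity) (gibbsWeight_le_one he k x)
    _ = _ := by
        rw [integral_fintype_prod_volume_eq_pow (fun x => |a x|), Fintype.card_fin]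

lemma gibbsTerm_zero (e a : Euc d → ℝ) : gibbsTerm e a 0 = 1 := by
  rw [gibbsTerm, Measure.volume_pi_eq_dirac]
  simp [gibbsWeight]

lemma summable_gibbsTerm (he : IsProfile e) (ha : Integrable a) : Summable (gibbsTerm e a) :=
  .of_norm_bounded (Real.summable_pow_div_factorial (∫ x, |a x|)) fun k => abs_gibbsTerm_le he ha k

lemma gibbsTerm_nonneg (he : IsProfile e) (ha : ∀ x, 0 ≤ a x) (k : ℕ) : 0 ≤ gibbsTerm e a k :=
  mul_nonneg (by positivity) (integral_nonneg fun x =>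
    mul_nonneg (Finset.prod_nonneg fun _ _ => ha _) (gibbsWeight_nonneg he k x))

lemma one_le_gibbsZ (he : IsProfile e) (hai : Integrable a) (ha : ∀ x, 0 ≤ a x) :
    1 ≤ gibbsZ e a := by
  rw [← gibbsTerm_zero e a]
  exact (summable_gibbsTerm he hai).le_tsum 0 fun k _ => gibbsTerm_nonneg he ha k

lemma gibbsZ_le_exp (he : IsProfile e) (hai : Integrable a) :
    |gibbsZ e a| ≤ Real.exp (∫ x, |a x|) := by
  rw [Real.exp_eq_exp_ℝ, NormedSpace.exp_eq_tsum_div, ← Real.norm_eq_abs]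
  exact tsum_of_norm_bounded (Real.summable_pow_div_factorial (∫ x, |a x|)).hasSum
    fun k => abs_gibbsTerm_le he hai k

lemma gibbsZ_mono (he : IsProfile e) (hai : Integrable a) (hbi : Integrable b) (ha : ∀ x, 0 ≤ a x)
    (hab : ∀ x, a x ≤ b x) : gibbsZ e a ≤ gibbsZ e b := by
  refine (summable_gibbsTerm he hai).tsum_le_tsum (fun k => ?_) (summable_gibbsTerm he hbi)
  refine mul_le_mul_of_nonneg_left (integral_mono (integrable_prod_mul_gibbsWeight he hai k)
    (integrable_prod_mul_gibbsWeight he hbi k) fun x => ?_) (by positivity)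
  exact mul_le_mul_of_nonneg_right (Finset.prod_le_prod (fun _ _ => ha _) fun _ _ => hab _)
    (gibbsWeight_nonneg he k x)

lemma gibbsTerm_translate (e a : Euc d → ℝ) (y : Euc d) (k : ℕ) :
    gibbsTerm e (fun x => a (x + y)) k = gibbsTerm e a k := by
  unfold gibbsTerm
  congr 1
  rw [← integral_add_right_eq_self (fun x : Fin k → Euc d => (∏ i, a (x i)) * gibbsWeight e k x)
    (fun _ => y)]
  simp [gibbsWeight]

lemma gibbsZ_translate (e a : Euc d → ℝ) (y : Euc d) :
    gibbsZ e (fun x => a (x + y)) = gibbsZ e a := by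
  simp only [gibbsZ, gibbsTerm_translate]

lemma measurable_gibbsTerm (he : Measurable e) {P : Type*} [MeasurableSpace P]
    {A : P → Euc d → ℝ} (hA : Measurable (Function.uncurry A)) (k : ℕ) :
    Measurable fun q => gibbsTerm e (A q) k := by
  have h1 : ∀ i : Fin k, Measurable fun w : P × (Fin k → Euc d) => A w.1 (w.2 i) := fun i =>
    hA.comp (g := Function.uncurry A)
      (f := fun w : P × (Fin k → Euc d) => (w.1, w.2 i)) (by fun_prop)
  have h2 := measurable_gibbsWeight he k
  have h3 : StronglyMeasurable (Function.uncurry fun (q : P) (x : Fin k → Euc d) =>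
      (∏ i, A q (x i)) * gibbsWeight e k x) := by
    refine Measurable.stronglyMeasurable ?_
    unfold Function.uncurry
    fun_prop
  unfold gibbsTerm
  exact h3.integral_prod_right.measurable.const_mul _

lemma measurable_gibbsZ (he : Measurable e) {P : Type*} [MeasurableSpace P]
    {A : P → Euc d → ℝ} (hA : Measurable (Function.uncurry A)) :
    Measurable fun q => gibbsZ e (A q) :=
  Measurable.tsum fun k => measurable_gibbsTerm he hA k

end partition

section derivative

variable {d : ℕ} {e a b c : Euc d → ℝ}

lemma integral_erase_prod_mul_gibbsWeight (he : IsProfile e) (hev : ∀ x, e (-x) = e x)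
    (hc : Integrable c) (hb : Integrable b) {k : ℕ} (j : Fin (k + 1)) :
    ∫ x : Fin (k + 1) → Euc d,
      ((∏ i ∈ Finset.univ.erase j, c (x i)) * b (x j)) * gibbsWeight e (k + 1) x =
    ∫ w, b w * ∫ x : Fin k → Euc d, (∏ i, c (x i) * e (w - x i)) * gibbsWeight e k x := by
  rw [← (volume_preserving_piFinSuccAbove (fun _ => Euc d) j).symm.integral_comp']
  have herase : ∀ (w : Euc d) (x : Fin k → Euc d), ∏ i ∈ Finset.univ.erase j,
      c (j.insertNth (α := fun _ => Euc d) w x i) = ∏ i, c (x i) := by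
    intro w x
    rw [← Finset.compl_singleton, ← Fin.image_succAbove_univ,
      Finset.prod_image (fun _ _ _ _ h => Fin.succAbove_right_injective h)]
    simp
  have hval : ∀ p : Euc d × (Fin k → Euc d),
      ((∏ i ∈ Finset.univ.erase j,
        c ((MeasurableEquiv.piFinSuccAbove (fun _ => Euc d) j).symm p i)) *
        b ((MeasurableEquiv.piFinSuccAbove (fun _ => Euc d) j).symm p j)) *
        gibbsWeight e (k + 1) ((MeasurableEquiv.piFinSuccAbove (fun _ => Euc d) j).symm p) =
      (b p.1 * ∏ i, c (p.2 i)) * ((∏ i, e (p.1 - p.2 i)) * gibbsWeight e k p.2) := by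
    intro p
    have := gibbsWeight_insertNth hev j p.1 p.2
    have h2 := herase p.1 p.2
    have h3 : j.insertNth (α := fun _ => Euc d) p.1 p.2 j = p.1 := Fin.insertNth_apply_same ..
    change ((∏ i ∈ Finset.univ.erase j, c (j.insertNth (α := fun _ => Euc d) p.1 p.2 i)) *
      b (j.insertNth (α := fun _ => Euc d) p.1 p.2 j)) *
      gibbsWeight e (k + 1) (j.insertNth (α := fun _ => Euc d) p.1 p.2) = _
    rw [this, h2, h3]
    ring
  have hInt : Integrable (fun p : Euc d × (Fin k → Euc d) =>
      (b p.1 * ∏ i, c (p.2 i)) * ((∏ i, e (p.1 - p.2 i)) * gibbsWeight e k p.2)) := by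
    have hm := he.measurable
    have hW := measurable_gibbsWeight he.measurable k
    refine (hb.mul_prod (integrable_prod_comp hc k)).mul_bdd (c := 1)
      (Measurable.aestronglyMeasurable (by fun_prop)) (Eventually.of_forall fun p => ?_)
    have h1 : 0 ≤ ∏ i, e (p.1 - p.2 i) := Finset.prod_nonneg fun _ _ => he.nonneg _
    have h2 : ∏ i, e (p.1 - p.2 i) ≤ 1 :=
      Finset.prod_le_one (fun _ _ => he.nonneg _) fun _ _ => he.le_one _
    have h3 := gibbsWeight_nonneg he k p.2
    rw [Real.norm_eq_abs, abs_of_nonneg (mul_nonneg h1 h3)]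
    exact mul_le_one₀ h2 h3 (gibbsWeight_le_one he k p.2)
  simp only [hval]
  rw [Measure.volume_eq_prod, integral_prod _ hInt]
  refine integral_congr_ae (Eventually.of_forall fun w => ?_)
  simp only [Finset.prod_mul_distrib, mul_assoc, integral_const_mul]

lemma hasDerivAt_gibbsTerm_succ (he : IsProfile e) (hev : ∀ x, e (-x) = e x)
    (ha : Integrable a) (hb : Integrable b) (k : ℕ) (s : ℝ) :
    HasDerivAt (fun s => gibbsTerm e (fun x => a x + s * b x) (k + 1))
      (∫ w, b w * gibbsTerm e (fun x => (a x + s * b x) * e (w - x)) k) s := by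
  have hab : ∀ t : ℝ, Integrable fun x => a x + t * b x := fun t => ha.add (hb.const_mul t)
  set F' : ℝ → (Fin (k + 1) → Euc d) → ℝ := fun t x =>
    ∑ j, ((∏ i ∈ Finset.univ.erase j, (a (x i) + t * b (x i))) * b (x j)) *
      gibbsWeight e (k + 1) x with hF'
  set M : Euc d → ℝ := fun x => |a x| + (|s| + 1) * |b x| with hM
  have hMi : Integrable M := ha.abs.add (hb.abs.const_mul _)
  have hcomp : ∀ {g : Euc d → ℝ}, Integrable g → ∀ i : Fin (k + 1),
      AEStronglyMeasurable (fun x : Fin (k + 1) → Euc d => g (x i)) := fun hg i =>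
    hg.aestronglyMeasurable.comp_quasiMeasurePreserving
      (Measure.quasiMeasurePreserving_eval (fun _ : Fin (k + 1) => (volume : Measure (Euc d))) i)
  have hW := (measurable_gibbsWeight he.measurable (k + 1)).aestronglyMeasurable
    (μ := (volume : Measure (Fin (k + 1) → Euc d)))
  have hbM : ∀ x, |b x| ≤ M x := fun x => by
    have := mul_nonneg (abs_nonneg s) (abs_nonneg (b x))
    have := abs_nonneg (a x)
    simp only [hM]; linarith
  have hcM : ∀ t ∈ Metric.ball s 1, ∀ x, |a x + t * b x| ≤ M x := fun t ht x => by
    have h1 : |t| ≤ |s| + 1 := by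
      rw [Metric.mem_ball, Real.dist_eq] at ht
      have := abs_add_le (t - s) s
      rw [sub_add_cancel] at this
      linarith
    refine (abs_add_le _ _).trans ?_
    rw [abs_mul]
    simp only [hM]
    gcongr
  have hbound : ∀ t ∈ Metric.ball s 1, ∀ (j : Fin (k + 1)) (x : Fin (k + 1) → Euc d),
      ‖((∏ i ∈ Finset.univ.erase j, (a (x i) + t * b (x i))) * b (x j)) *
        gibbsWeight e (k + 1) x‖ ≤ ∏ i, M (x i) := by
    intro t ht j x
    rw [norm_mul, norm_mul, norm_prod, ← Finset.prod_erase_mul _ _ (Finset.mem_univ j)]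
    have hM0 : ∀ x, 0 ≤ M x := fun x => (abs_nonneg _).trans (hbM x)
    have h1 : ∏ i ∈ Finset.univ.erase j, ‖a (x i) + t * b (x i)‖ ≤
        ∏ i ∈ Finset.univ.erase j, M (x i) :=
      Finset.prod_le_prod (fun _ _ => norm_nonneg _) fun i _ => hcM t ht (x i)
    have h2 : ‖gibbsWeight e (k + 1) x‖ ≤ 1 := by
      rw [Real.norm_eq_abs, abs_of_nonneg (gibbsWeight_nonneg he _ x)]
      exact gibbsWeight_le_one he _ x
    have h3 := mul_le_mul h1 (hbM (x j)) (abs_nonneg _) (Finset.prod_nonneg fun _ _ => hM0 _)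
    exact (mul_le_of_le_one_right (by positivity) h2).trans h3
  have hmeas : ∀ j : Fin (k + 1), AEStronglyMeasurable fun x : Fin (k + 1) → Euc d =>
      ((∏ i ∈ Finset.univ.erase j, (a (x i) + s * b (x i))) * b (x j)) *
        gibbsWeight e (k + 1) x := fun j =>
    ((Finset.aestronglyMeasurable_fun_prod _ fun i _ => hcomp (hab s) i).mul (hcomp hb j)).mul hW
  have key := hasDerivAt_integral_of_dominated_loc_of_deriv_le (μ := volume)
    (F := fun t (x : Fin (k + 1) → Euc d) =>
      (∏ i, (a (x i) + t * b (x i))) * gibbsWeight e (k + 1) x) (F' := F') (x₀ := s)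
    (bound := fun x => ((k + 1 : ℕ) : ℝ) * ∏ i, M (x i)) (Metric.ball_mem_nhds s one_pos)
    (Eventually.of_forall fun t =>
      (integrable_prod_mul_gibbsWeight he (hab t) (k + 1)).aestronglyMeasurable)
    (integrable_prod_mul_gibbsWeight he (hab s) (k + 1)) ?_ ?_
    ((integrable_prod_comp hMi (k + 1)).const_mul _) ?_
  · have hd := key.2.const_mul (((k + 1).factorial : ℝ)⁻¹)
    refine hd.congr_deriv ?_
    have hj : ∀ j : Fin (k + 1), Integrable fun x : Fin (k + 1) → Euc d =>
        ((∏ i ∈ Finset.univ.erase j, (a (x i) + s * b (x i))) * b (x j)) *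
          gibbsWeight e (k + 1) x := fun j =>
      (integrable_prod_comp hMi (k + 1)).mono' (hmeas j)
        (Eventually.of_forall (hbound s (Metric.mem_ball_self one_pos) j))
    rw [hF', integral_finsetSum _ fun j _ => hj j]
    simp only [integral_erase_prod_mul_gibbsWeight he hev (hab s) hb, gibbsTerm]
    rw [Finset.sum_const, Finset.card_univ, Fintype.card_fin, nsmul_eq_mul, Nat.factorial_succ]
    simp only [mul_left_comm _ ((k.factorial : ℝ)⁻¹), integral_const_mul]
    push_cast
    field_simp
  · exact Finset.aestronglyMeasurable_fun_sum _ fun j _ => hmeas j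
  · refine Eventually.of_forall fun x t ht => ?_
    refine (norm_sum_le_of_le _ fun j _ => hbound t ht j x).trans (le_of_eq ?_)
    rw [Finset.sum_const, Finset.card_univ, Fintype.card_fin, nsmul_eq_mul]
  · refine Eventually.of_forall fun x t ht => ?_
    have := (HasDerivAt.fun_finsetProd (u := Finset.univ) (f := fun i t => a (x i) + t * b (x i))
      (f' := fun i => b (x i)) (x := t) fun i _ => by
        simpa using ((hasDerivAt_id t).mul_const (b (x i))).const_add (a (x i))).mul_const
          (gibbsWeight e (k + 1) x)
    refine this.congr_deriv ?_
    simp only [hF', Finset.sum_mul, smul_eq_mul]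

lemma IsProfile.integrable_mul_sub (he : IsProfile e) (hc : Integrable c) (w : Euc d) :
    Integrable fun x => c x * e (w - x) := by
  have hm := he.measurable
  refine hc.mul_bdd (c := 1) (Measurable.aestronglyMeasurable (by fun_prop))
    (Eventually.of_forall fun x => ?_)
  rw [Real.norm_eq_abs, abs_of_nonneg (he.nonneg _)]
  exact he.le_one _

lemma abs_gibbsTerm_mul_sub_le (he : IsProfile e) (hc : Integrable c) (w : Euc d) (k : ℕ) :
    |gibbsTerm e (fun x => c x * e (w - x)) k| ≤ (∫ x, |c x|) ^ k / k.factorial := by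
  refine (abs_gibbsTerm_le he (he.integrable_mul_sub hc w) k).trans ?_
  gcongr ?_ ^ k / _
  refine integral_mono (he.integrable_mul_sub hc w).abs hc.abs fun x => ?_
  rw [abs_mul, abs_of_nonneg (he.nonneg (w - x))]
  exact mul_le_of_le_one_right (abs_nonneg _) (he.le_one _)

/-- The derivative of the partition function along a line of activity functions. -/
lemma hasDerivAt_gibbsZ (he : IsProfile e) (hev : ∀ x, e (-x) = e x)
    (ha : Integrable a) (hb : Integrable b) (ham : Measurable a) (hbm : Measurable b) (s : ℝ) :
    HasDerivAt (fun s => gibbsZ e (fun x => a x + s * b x))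
      (∫ w, b w * gibbsZ e (fun x => (a x + s * b x) * e (w - x))) s := by
  have hab : ∀ t : ℝ, Integrable fun x => a x + t * b x := fun t => ha.add (hb.const_mul t)
  set M : ℝ := ∫ x, (|a x| + (|s| + 1) * |b x|) with hM
  have hMt : ∀ t ∈ Metric.ball s 1, ∫ x, |a x + t * b x| ≤ M := by
    intro t ht
    refine integral_mono (hab t).abs (ha.abs.add (hb.abs.const_mul _)) fun x => ?_
    have h1 : |t| ≤ |s| + 1 := by
      rw [Metric.mem_ball, Real.dist_eq] at ht
      have := abs_add_le (t - s) s
      rw [sub_add_cancel] at this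
      linarith
    refine (abs_add_le _ _).trans ?_
    rw [abs_mul]
    dsimp only [Pi.add_apply]
    gcongr
  have hbnd : ∀ t ∈ Metric.ball s 1, ∀ k w,
      ‖b w * gibbsTerm e (fun x => (a x + t * b x) * e (w - x)) k‖ ≤
        |b w| * (M ^ k / k.factorial) := by
    intro t ht k w
    rw [norm_mul]
    refine mul_le_mul_of_nonneg_left ((abs_gibbsTerm_mul_sub_le he (hab t) w k).trans ?_)
      (norm_nonneg _)
    gcongr
    exact hMt t ht
  have hsum : Summable fun k : ℕ => (∫ w, |b w|) * (M ^ k / k.factorial) :=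
    (Real.summable_pow_div_factorial M).mul_left _
  have hseries := hasDerivAt_tsum_of_isPreconnected hsum Metric.isOpen_ball
    (convex_ball s 1).isPreconnected
    (fun k t _ => hasDerivAt_gibbsTerm_succ he hev ha hb k t) (fun k t ht => by
      rw [← integral_mul_const]
      exact norm_integral_le_of_norm_le (hb.abs.mul_const _)
        (Eventually.of_forall (hbnd t ht k)))
    (Metric.mem_ball_self one_pos)
    ((summable_nat_add_iff 1).2 (summable_gibbsTerm he (hab s))) (Metric.mem_ball_self one_pos)
  have hZ : (fun s => gibbsZ e (fun x => a x + s * b x)) = fun s =>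
      1 + ∑' k, gibbsTerm e (fun x => a x + s * b x) (k + 1) := by
    funext t
    rw [gibbsZ, (summable_gibbsTerm he (hab t)).tsum_eq_zero_add, gibbsTerm_zero]
  rw [hZ]
  refine (hseries.const_add 1).congr_deriv ?_
  have hs := Metric.mem_ball_self (x := s) one_pos
  have hInt : ∀ k, Integrable fun w =>
      b w * gibbsTerm e (fun x => (a x + s * b x) * e (w - x)) k := by
    intro k
    have hem := he.measurable
    have hm : Measurable fun w => gibbsTerm e (fun x => (a x + s * b x) * e (w - x)) k :=
      measurable_gibbsTerm hem (A := fun w x => (a x + s * b x) * e (w - x))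
        (by unfold Function.uncurry; fun_prop) k
    exact (hb.abs.mul_const _).mono' (hbm.mul hm).aestronglyMeasurable
      (Eventually.of_forall (hbnd s hs k))
  have hnorm : Summable fun k => ∫ w,
      ‖b w * gibbsTerm e (fun x => (a x + s * b x) * e (w - x)) k‖ := by
    refine .of_nonneg_of_le (fun k => integral_nonneg fun _ => norm_nonneg _) (fun k => ?_) hsum
    rw [← integral_mul_const]
    exact integral_mono (hInt k).norm (hb.abs.mul_const _) (hbnd s hs k)
  rw [(hasSum_integral_of_summable_integral_norm hInt hnorm).tsum_eq]
  simp only [gibbsZ, tsum_mul_left]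

end derivative

section ratio

variable {d : ℕ} {e f a b α : Euc d → ℝ} {lam : ℝ}

lemma gibbsZ_mul_sub_div_mem (he : IsProfile e) (hai : Integrable a) (ha : ∀ x, 0 ≤ a x)
    (w : Euc d) : 0 ≤ gibbsZ e (fun x => a x * e (w - x)) / gibbsZ e a ∧
      gibbsZ e (fun x => a x * e (w - x)) / gibbsZ e a ≤ 1 := by
  have h0 : ∀ x, 0 ≤ a x * e (w - x) := fun x => mul_nonneg (ha x) (he.nonneg _)
  have h1 := one_le_gibbsZ he hai ha
  have h2 := one_le_gibbsZ he (he.integrable_mul_sub hai w) h0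
  have h3 := gibbsZ_mono he (he.integrable_mul_sub hai w) hai h0 fun x =>
    mul_le_of_le_one_right (ha x) (he.le_one _)
  exact ⟨by positivity, (div_le_one (by positivity)).2 h3⟩

lemma measurable_gibbsZ_line (he : Measurable e) (ham : Measurable a) (hbm : Measurable b) :
    Measurable fun p : ℝ × Euc d => b p.2 * (gibbsZ e (fun x => (a x + p.1 * b x) * e (p.2 - x)) /
      gibbsZ e (fun x => a x + p.1 * b x)) := by
  have h1 : Measurable fun p : ℝ × Euc d =>
      gibbsZ e (fun x => (a x + p.1 * b x) * e (p.2 - x)) :=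
    measurable_gibbsZ he (A := fun (p : ℝ × Euc d) x => (a x + p.1 * b x) * e (p.2 - x))
      (by unfold Function.uncurry; fun_prop)
  have h2 : Measurable fun p : ℝ × Euc d => gibbsZ e (fun x => a x + p.1 * b x) :=
    measurable_gibbsZ he (A := fun (p : ℝ × Euc d) x => a x + p.1 * b x)
      (by unfold Function.uncurry; fun_prop)
  fun_prop

/-- The increment of the logarithm of the partition function along a line of activities. -/
lemma log_gibbsZ_sub (he : IsProfile e) (hev : ∀ x, e (-x) = e x)
    (ha : Integrable a) (hb : Integrable b) (ham : Measurable a) (hbm : Measurable b) {T : ℝ}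
    (hT : 0 ≤ T) (hpos : ∀ s ∈ Set.Icc 0 T, ∀ x, 0 ≤ a x + s * b x) :
    Real.log (gibbsZ e (fun x => a x + T * b x)) - Real.log (gibbsZ e a) =
      ∫ s in (0 : ℝ)..T, ∫ w, b w * (gibbsZ e (fun x => (a x + s * b x) * e (w - x)) /
        gibbsZ e (fun x => a x + s * b x)) := by
  have hab : ∀ t : ℝ, Integrable fun x => a x + t * b x := fun t => ha.add (hb.const_mul t)
  have hderiv : ∀ s ∈ Set.uIcc 0 T, HasDerivAt
      (fun s => Real.log (gibbsZ e (fun x => a x + s * b x)))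
      (∫ w, b w * (gibbsZ e (fun x => (a x + s * b x) * e (w - x)) /
        gibbsZ e (fun x => a x + s * b x))) s := by
    intro s hs
    rw [Set.uIcc_of_le hT] at hs
    have h1 := one_le_gibbsZ he (hab s) (hpos s hs)
    refine ((hasDerivAt_gibbsZ he hev ha hb ham hbm s).log (by positivity)).congr_deriv ?_
    rw [← integral_div]
    simp only [mul_div_assoc]
  have hInt : IntervalIntegrable (fun s => ∫ w, b w *
      (gibbsZ e (fun x => (a x + s * b x) * e (w - x)) /
        gibbsZ e (fun x => a x + s * b x))) volume 0 T := by
    rw [intervalIntegrable_iff, Set.uIoc_of_le hT]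
    have hm := StronglyMeasurable.integral_prod_right (ν := (volume : Measure (Euc d)))
      (f := fun s w => b w * (gibbsZ e (fun x => (a x + s * b x) * e (w - x)) /
        gibbsZ e (fun x => a x + s * b x)))
      (measurable_gibbsZ_line he.measurable ham hbm).stronglyMeasurable
    refine Measure.integrableOn_of_bounded (M := ∫ w, |b w|) (by simp) hm.aestronglyMeasurable ?_
    refine (ae_restrict_iff' measurableSet_Ioc).2 (Eventually.of_forall fun s hs => ?_)
    refine norm_integral_le_of_norm_le hb.abs (Eventually.of_forall fun w => ?_)
    have h1 := gibbsZ_mul_sub_div_mem he (hab s) (hpos s ⟨hs.1.le, hs.2⟩) w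
    rw [norm_mul]
    refine mul_le_of_le_one_right (norm_nonneg _) ?_
    rw [Real.norm_eq_abs, abs_of_nonneg h1.1]
    exact h1.2
  rw [intervalIntegral.integral_eq_sub_of_hasDerivAt hderiv hInt]
  simp

/-- The ratio of the partition functions with and without a particle at the origin. -/
def gibbsRatio (e : Euc d → ℝ) (lam : ℝ) (α : Euc d → ℝ) : ℝ :=
  gibbsZ e (fun x => lam * α x * e x) / gibbsZ e (fun x => lam * α x)

lemma gibbsRatio_translate (hev : ∀ x, e (-x) = e x) (a : Euc d → ℝ) (w : Euc d)
    (hα : ∀ x, lam * α x = a (x + w)) :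
    gibbsZ e (fun x => a x * e (w - x)) / gibbsZ e a = gibbsRatio e lam α := by
  rw [gibbsRatio, ← gibbsZ_translate e (fun x => a x * e (w - x)) w, ← gibbsZ_translate e a w]
  simp only [hα, sub_add_cancel_right, hev]

lemma gibbsRatio_mem (he : IsProfile e) (hev : ∀ x, e (-x) = e x) (hlam : 0 ≤ lam)
    (hα : IsProfile α) (hαi : Integrable α) :
    0 ≤ gibbsRatio e lam α ∧ gibbsRatio e lam α ≤ 1 := by
  have := gibbsZ_mul_sub_div_mem he (hαi.const_mul lam)
    (fun x => mul_nonneg hlam (hα.nonneg x)) 0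
  rwa [gibbsRatio_translate hev _ 0 (α := α) (lam := lam) fun x => by rw [add_zero]] at this

lemma measurable_gibbsRatio (he : Measurable e) {P : Type*} [MeasurableSpace P]
    {A : P → Euc d → ℝ} {l : P → ℝ} (hl : Measurable l) (hA : Measurable (Function.uncurry A)) :
    Measurable fun q => gibbsRatio e (l q) (A q) := by
  have hA' : Measurable fun w : P × Euc d => A w.1 w.2 := hA
  have h1 : Measurable fun q => gibbsZ e (fun x => l q * A q x * e x) :=
    measurable_gibbsZ he (A := fun q x => l q * A q x * e x) (by unfold Function.uncurry; fun_prop)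
  have h2 : Measurable fun q => gibbsZ e (fun x => l q * A q x) :=
    measurable_gibbsZ he (A := fun q x => l q * A q x) (by unfold Function.uncurry; fun_prop)
  exact h1.div h2

lemma integrable_reroot (hf : IsProfile f) (hα : IsProfile α) (hαi : Integrable α)
    (s : unitInterval) (y : Euc d) : Integrable (reroot f α s y) := by
  refine (hαi.comp_add_right y).mono' (hf.reroot hα s y).measurable.aestronglyMeasurable
    (Eventually.of_forall fun x => ?_)
  rw [Real.norm_eq_abs, abs_of_nonneg ((hf.reroot hα s y).nonneg x)]
  refine mul_le_of_le_one_right (hα.nonneg _) ?_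
  linarith [mul_nonneg s.2.1 (hf.nonneg (x + y))]

lemma aestronglyMeasurable_gibbsRatio_reroot (he : Measurable e) (hf : Measurable f)
    (hα : Measurable α) (lam : ℝ) : AEStronglyMeasurable
      (fun p : unitInterval × Euc d => gibbsRatio e lam (reroot f α p.1 p.2)) volume := by
  refine (measurable_gibbsRatio he measurable_const
    (A := fun p : unitInterval × Euc d => reroot f α p.1 p.2) ?_).aestronglyMeasurable
  unfold reroot Function.uncurry
  fun_prop

/-- The ratio of partition functions satisfies an exact tree-like recursion. -/
lemma gibbsRatio_eq_exp (he : IsProfile e) (hev : ∀ x, e (-x) = e x) (hf : IsProfile f)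
    (hfi : Integrable f) (hfe : ∀ x, e x = 1 - f x) (hlam : 0 ≤ lam) (hα : IsProfile α)
    (hαi : Integrable α) :
    gibbsRatio e lam α = Real.exp (-(lam * ∫ p : unitInterval × Euc d,
      stepKernel f α p * gibbsRatio e lam (reroot f α p.1 p.2))) := by
  have hfev : ∀ x, f (-x) = f x := fun x => by linarith [hfe x, hfe (-x), hev x]
  have hαm := hα.measurable
  have hfm := hf.measurable
  have hbi : Integrable fun x => -(lam * (α x * f x)) :=
    ((hαi.mul_bdd (c := 1) hfm.aestronglyMeasurable (Eventually.of_forall fun x => by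
      rw [Real.norm_eq_abs, abs_of_nonneg (hf.nonneg _)]; exact hf.le_one x)).const_mul lam).neg
  have hline : ∀ s x, lam * α x + s * -(lam * (α x * f x)) = lam * (α x * (1 - s * f x)) :=
    fun s x => by ring
  have hpos : ∀ s ∈ Set.Icc (0 : ℝ) 1, ∀ x, 0 ≤ lam * α x + s * -(lam * (α x * f x)) := by
    intro s hs x
    rw [hline]
    have := mul_le_one₀ hs.2 (hf.nonneg x) (hf.le_one x)
    exact mul_nonneg hlam (mul_nonneg (hα.nonneg x) (by linarith))
  have hlog := log_gibbsZ_sub he hev (hαi.const_mul lam) hbi (by fun_prop) (by fun_prop)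
    zero_le_one hpos
  have h0 := one_le_gibbsZ he (hαi.const_mul lam) fun x => mul_nonneg hlam (hα.nonneg x)
  have h1 : 1 ≤ gibbsZ e (fun x => lam * α x * e x) := by
    refine one_le_gibbsZ he ((hαi.const_mul lam).mul_bdd (c := 1)
      he.measurable.aestronglyMeasurable (Eventually.of_forall fun x => ?_))
      fun x => mul_nonneg (mul_nonneg hlam (hα.nonneg x)) (he.nonneg x)
    rw [Real.norm_eq_abs, abs_of_nonneg (he.nonneg _)]; exact he.le_one x
  have hend : (fun x => lam * α x + 1 * -(lam * (α x * f x))) = fun x => lam * α x * e x := by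
    funext x
    rw [hfe]; ring
  rw [hend, ← Real.log_div (by positivity) (by positivity)] at hlog
  have hratio : ∀ s w, gibbsZ e (fun x => (lam * α x + s * -(lam * (α x * f x))) * e (w - x)) /
      gibbsZ e (fun x => lam * α x + s * -(lam * (α x * f x))) =
      gibbsRatio e lam (reroot f α s w) := fun s w =>
    gibbsRatio_translate hev (fun x => lam * α x + s * -(lam * (α x * f x))) w fun x => by
      rw [hline]; rfl
  simp only [hratio] at hlog
  have hgi : Integrable fun p : unitInterval × Euc d =>
      stepKernel f α p * gibbsRatio e lam (reroot f α p.1 p.2) := by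
    refine (integrable_stepKernel hf hfi hα).mul_bdd (c := 1)
      (aestronglyMeasurable_gibbsRatio_reroot he.measurable hfm hαm lam)
      (Eventually.of_forall fun p => ?_)
    have := gibbsRatio_mem he hev hlam (hf.reroot hα p.1 p.2) (integrable_reroot hf hα hαi p.1 p.2)
    rw [Real.norm_eq_abs, abs_of_nonneg this.1]
    exact this.2
  rw [← Real.exp_log (show 0 < gibbsRatio e lam α from div_pos (by positivity) (by positivity))]
  congr 1
  rw [gibbsRatio, hlog, Measure.volume_eq_prod, integral_prod _ hgi,
    intervalIntegral.integral_of_le zero_le_one, ← integral_Icc_eq_integral_Ioc,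
    ← integral_subtype measurableSet_Icc, ← neg_mul, ← integral_const_mul]
  refine integral_congr_ae (Eventually.of_forall fun s => ?_)
  dsimp only
  rw [← integral_const_mul]
  refine integral_congr_ae (Eventually.of_forall fun w => ?_)
  simp only [stepKernel]
  ring

/-- The ratio of partition functions is approximated by the iterates, uniformly. -/
lemma abs_gibbsRatio_sub_le (he : IsProfile e) (hev : ∀ x, e (-x) = e x) (hf : IsProfile f)
    (hfi : Integrable f) (hfe : ∀ x, e x = 1 - f x) {C κ : ℝ} (hC : ∫ x, f x = C) (hCpos : 0 < C)
    (hlam : 0 ≤ lam) (hκ : ∀ s : ℝ, 0 ≤ s →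
      lam * C * Real.exp (-s) * (1 + s) ≤ κ * (1 + lam * C * Real.exp (-s))) (hκ0 : 0 ≤ κ)
    (n : ℕ) (hα : IsProfile α) (hαi : Integrable α) :
    |gibbsRatio e lam α - realRatioIter f lam (n + 1) α| ≤
      (1 + lam * C) * (κ ^ n * (lam * C)) :=
  abs_sub_le_of_recursion hf hfi hC hCpos hlam hκ hκ0 (S := {α | IsProfile α ∧ Integrable α})
    (u := fun _ => gibbsRatio e lam) (v := realRatioIter f lam)
    (fun _ h => h.1) (fun _ h s y => ⟨hf.reroot h.1 s y, integrable_reroot hf h.1 h.2 s y⟩)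
    (fun _ _ h => gibbsRatio_mem he hev hlam h.1 h.2)
    (fun n _ h => realRatioIter_mem hf hlam n h.1)
    (fun _ _ h => aestronglyMeasurable_gibbsRatio_reroot he.measurable hf.measurable
      h.1.measurable lam)
    (fun n _ h => aestronglyMeasurable_realRatioIter_reroot hf.measurable h.1.measurable lam n)
    (fun _ _ h => gibbsRatio_eq_exp he hev hf hfi hfe hlam h.1 h.2) (fun _ _ _ => rfl) n ⟨hα, hαi⟩

end ratio

section analytic

lemma isProfile_one {d : ℕ} : IsProfile (fun _ : Euc d => (1 : ℝ)) :=
  ⟨measurable_const, fun _ => zero_le_one, fun _ => le_rfl⟩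

/-- A geometric bound on increments over a set gives uniform convergence to a limit. -/
lemma tendstoUniformlyOn_limUnder_of_geometric {F : ℕ → ℂ → ℂ} {S : Set ℂ} {κ K : ℝ}
    (hκ1 : κ < 1) (hκ0 : 0 ≤ κ) {N : ℕ}
    (h : ∀ z ∈ S, ∀ n, ‖F (N + n + 1) z - F (N + n) z‖ ≤ K * κ ^ n) :
    TendstoUniformlyOn F (fun z => limUnder atTop fun n => F n z) atTop S := by
  have hd : ∀ z ∈ S, ∀ n, dist (F (n + N) z) (F (n + 1 + N) z) ≤ K * κ ^ n := by
    intro z hz n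
    rw [dist_comm, dist_eq_norm, show n + 1 + N = N + n + 1 by ring, add_comm n N]
    exact h z hz n
  have hlim : ∀ z ∈ S, Tendsto (fun n => F (n + N) z) atTop
      (nhds (limUnder atTop fun n => F n z)) := fun z hz => by
    have h1 := cauchySeq_tendsto_of_complete (cauchySeq_of_le_geometric κ K hκ1 (hd z hz))
    have h2 : ∃ l, Tendsto (fun n => F n z) atTop (nhds l) :=
      h1.imp fun l hl => (tendsto_add_atTop_iff_nat (f := fun n => F n z) N).1 hl
    exact (tendsto_add_atTop_iff_nat (f := fun n => F n z) N).2 (tendsto_nhds_limUnder h2)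
  rw [Metric.tendstoUniformlyOn_iff]
  intro ε hε
  have h0 : Tendsto (fun n => K * κ ^ n / (1 - κ)) atTop (nhds 0) := by
    simpa using ((tendsto_pow_atTop_nhds_zero_of_lt_one hκ0 hκ1).const_mul K).div_const (1 - κ)
  obtain ⟨n₀, hn₀⟩ := eventually_atTop.1 (h0.eventually_lt_const hε)
  refine eventually_atTop.2 ⟨n₀ + N, fun n hn z hz => ?_⟩
  have := dist_le_of_le_geometric_of_tendsto κ K hκ1 (hd z hz) (hlim z hz) (n - N)
  rw [Nat.sub_add_cancel (by omega)] at this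
  rw [dist_comm]
  exact this.trans_lt (hn₀ _ (by omega))

/-- The iterates at the constant profile converge to a function that is holomorphic near
`[0, e / C)`. -/
lemma exists_differentiableOn_limit {d : ℕ} {f : Euc d → ℝ} {C : ℝ} (hf : IsProfile f)
    (hfi : Integrable f) (hC : ∫ x, f x = C) (hCpos : 0 < C) :
    ∃ U : Set ℂ, IsOpen U ∧ (∀ t ∈ Set.Ico 0 (Real.exp 1 / C), (t : ℂ) ∈ U) ∧
      ∃ R : ℂ → ℂ, DifferentiableOn ℂ R U ∧
        ∀ z ∈ U, Tendsto (fun n => ratioIter f z n fun _ => 1) atTop (nhds (R z)) := by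
  have hball : ∀ t : Set.Ico 0 (Real.exp 1 / C), ∃ δ > 0, TendstoUniformlyOn
      (fun n z => ratioIter f z n fun _ => 1)
      (fun z => limUnder atTop fun n => ratioIter f z n fun _ => 1) atTop
      (Metric.ball ((t : ℝ) : ℂ) δ) := by
    intro t
    obtain ⟨δ, hδ, κ, hκ0, hκ1, K, N, h⟩ :=
      exists_ball_ratioIter_geometric hf hfi hC hCpos t.2.1 ((lt_div_iff₀ hCpos).1 t.2.2)
    exact ⟨δ, hδ, tendstoUniformlyOn_limUnder_of_geometric
      (F := fun n z => ratioIter f z n fun _ => 1) hκ1 hκ0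
      fun z hz n => h z hz n _ isProfile_one⟩
  choose δ hδ hunif using hball
  refine ⟨⋃ t : Set.Ico 0 (Real.exp 1 / C), Metric.ball ((t : ℝ) : ℂ) (δ t),
    isOpen_iUnion fun _ => Metric.isOpen_ball,
    fun t ht => Set.mem_iUnion.2 ⟨⟨t, ht⟩, Metric.mem_ball_self (hδ _)⟩,
    fun z => limUnder atTop fun n => ratioIter f z n fun _ => 1, fun z hz => ?_, fun z hz => ?_⟩
  · obtain ⟨t, ht⟩ := Set.mem_iUnion.1 hz
    have := (hunif t).tendstoLocallyUniformlyOn.differentiableOn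
      (Eventually.of_forall fun n =>
        (differentiable_ratioIter hf hfi n isProfile_one).differentiableOn) Metric.isOpen_ball
    exact (this.differentiableAt (Metric.isOpen_ball.mem_nhds ht)).differentiableWithinAt
  · obtain ⟨t, ht⟩ := Set.mem_iUnion.1 hz
    exact (hunif t).tendsto_at ht

/-- The primitive of a function holomorphic near `[0, c)` is analytic near `[0, c)`. -/
lemma exists_analyticOnNhd_primitive {U : Set ℂ} (hU : IsOpen U) {c : ℝ}
    (hcU : ∀ t ∈ Set.Ico 0 c, (t : ℂ) ∈ U) {R : ℂ → ℂ} (hR : DifferentiableOn ℂ R U) :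
    ∃ Ω : Set ℂ, IsOpen Ω ∧ (∀ t ∈ Set.Ico 0 c, (t : ℂ) ∈ Ω) ∧ ∃ p : ℂ → ℂ,
      AnalyticOnNhd ℂ p Ω ∧ ∀ t ∈ Set.Ico 0 c, p t = ∫ s in (0 : ℝ)..t, R s := by
  set Ω : Set ℂ := {z | ∀ s : unitInterval, ((s : ℝ) : ℂ) * z ∈ U} with hΩ
  have hΩo : IsOpen Ω := by
    have h1 : IsClosed {q : unitInterval × ℂ | ((q.1 : ℝ) : ℂ) * q.2 ∉ U} :=
      (hU.preimage (f := fun q : unitInterval × ℂ => ((q.1 : ℝ) : ℂ) * q.2)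
        (by fun_prop)).isClosed_compl
    have h2 := isClosedMap_snd_of_compactSpace _ h1
    convert h2.isOpen_compl using 1
    ext z
    simp [hΩ]
  have hmem : ∀ z ∈ Ω, ∀ s : unitInterval, ((s : ℝ) : ℂ) * z ∈ U := fun z hz s => hz s
  have hjoint : ContinuousOn (fun q : ℂ × unitInterval => q.1 * R (((q.2 : ℝ) : ℂ) * q.1))
      (Ω ×ˢ Set.univ) :=
    continuousOn_fst.mul (hR.continuousOn.comp (by fun_prop) fun q hq => hq.1 q.2)
  have hdiff : DifferentiableOn ℂ
      (fun z => ∫ s : unitInterval, z * R (((s : ℝ) : ℂ) * z)) Ω := by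
    refine differentiableOn_integral_of_dominated hΩo (fun z hz => ?_) (fun s => ?_)
      fun z₀ hz₀ => ?_
    · have : Continuous fun s : unitInterval => z * R (((s : ℝ) : ℂ) * z) :=
        continuousOn_univ.1 (hjoint.comp (f := fun s : unitInterval => (z, s)) (by fun_prop)
          fun s _ => ⟨hz, trivial⟩)
      exact this.aestronglyMeasurable
    · exact differentiableOn_id.mul (hR.comp (by fun_prop) fun z hz => hz s)
    · obtain ⟨r, hr, hsub⟩ := Metric.nhds_basis_closedBall.mem_iff.1 (hΩo.mem_nhds hz₀)
      obtain ⟨B, hB⟩ := ((isCompact_closedBall z₀ r).prod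
        (isCompact_univ (X := unitInterval))).exists_bound_of_continuousOn
          (hjoint.mono (Set.prod_mono hsub Set.Subset.rfl))
      exact ⟨r, hr, fun _ => B, integrable_const B, Metric.ball_subset_closedBall.trans hsub,
        fun z hz s => hB (z, s) ⟨Metric.ball_subset_closedBall hz, trivial⟩⟩
  refine ⟨Ω, hΩo, fun t ht s => ?_, _, hdiff.analyticOnNhd hΩo, fun t ht => ?_⟩
  · rw [← Complex.ofReal_mul]
    exact hcU _ ⟨mul_nonneg s.2.1 ht.1, (mul_le_of_le_one_left ht.1 s.2.2).trans_lt ht.2⟩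
  · have h1 := intervalIntegral.smul_integral_comp_mul_left (a := 0) (b := 1)
      (fun s : ℝ => R s) t
    rw [mul_zero, mul_one] at h1
    rw [← h1, integral_const_mul, intervalIntegral.integral_of_le zero_le_one,
      ← integral_Icc_eq_integral_Ioc, ← integral_subtype measurableSet_Icc]
    simp [mul_comm]

end analytic

section cubes

variable {d : ℕ} {V : ℝ}

lemma cube_eq_preimage (d : ℕ) (V : ℝ) : cube d V = WithLp.ofLp ⁻¹'
    Set.Icc (fun _ : Fin d => -(V ^ (1 / (d : ℝ)) / 2)) (fun _ => V ^ (1 / (d : ℝ)) / 2) := by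
  ext x
  simp [cube, Set.mem_Icc, Pi.le_def, abs_le, forall_and]

lemma measurableSet_cube (d : ℕ) (V : ℝ) : MeasurableSet (cube d V) := by
  rw [cube_eq_preimage]
  exact (PiLp.volume_preserving_ofLp (Fin d)).measurable measurableSet_Icc

lemma volume_cube (d : ℕ) (V : ℝ) :
    volume (cube d V) = ENNReal.ofReal (V ^ (1 / (d : ℝ))) ^ d := by
  rw [cube_eq_preimage, (PiLp.volume_preserving_ofLp (Fin d)).measure_preimage
    measurableSet_Icc.nullMeasurableSet, Real.volume_Icc_pi]
  simp

lemma ae_restrict_cube_one (d : ℕ) :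
    ∀ᵐ u ∂(volume : Measure (Euc d)).restrict (cube d 1), ∀ i, |u i| < 1 / 2 := by
  rw [ae_restrict_iff' (measurableSet_cube d 1), cube_eq_preimage]
  have h := (Measure.univ_pi_Ioo_ae_eq_Icc (μ := fun _ : Fin d => (volume : Measure ℝ))
    (f := fun _ => -((1 : ℝ) ^ (1 / (d : ℝ)) / 2))
    (g := fun _ => (1 : ℝ) ^ (1 / (d : ℝ)) / 2)).mem_iff
  filter_upwards [(PiLp.volume_preserving_ofLp (Fin d)).quasiMeasurePreserving.ae h]
    with u hu hmem i
  have := hu.2 hmem i trivial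
  simpa [abs_lt] using this

lemma rpow_one_div_pow (hd : 1 ≤ d) (hV : 0 ≤ V) : (V ^ (1 / (d : ℝ))) ^ d = V := by
  rw [one_div, Real.rpow_inv_natCast_pow hV (by omega)]

lemma smul_mem_cube_iff (hV : 0 < V) (u : Euc d) :
    V ^ (1 / (d : ℝ)) • u ∈ cube d V ↔ u ∈ cube d 1 := by
  have hr : 0 < V ^ (1 / (d : ℝ)) := Real.rpow_pos_of_pos hV _
  simp only [cube, Set.mem_ofPred_eq, PiLp.smul_apply, smul_eq_mul, abs_mul, abs_of_pos hr,
    Real.one_rpow]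
  refine forall_congr' fun i => ?_
  rw [div_eq_mul_one_div (V ^ (1 / (d : ℝ))), mul_le_mul_iff_right₀ hr]

lemma setIntegral_cube_eq (hd : 1 ≤ d) (hV : 0 < V) (h : Euc d → ℝ) :
    ∫ w in cube d V, h w = V * ∫ u in cube d 1, h (V ^ (1 / (d : ℝ)) • u) := by
  have hr : 0 < V ^ (1 / (d : ℝ)) := Real.rpow_pos_of_pos hV _
  have hs := Measure.integral_comp_smul_of_nonneg (volume : Measure (Euc d))
    ((cube d V).indicator h) (V ^ (1 / (d : ℝ))) (hR := hr.le)
  rw [finrank_euclideanSpace_fin, rpow_one_div_pow hd hV.le,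
    integral_indicator (measurableSet_cube d V), smul_eq_mul] at hs
  rw [← integral_indicator (measurableSet_cube d 1)]
  have hind : ∀ u, (cube d V).indicator h (V ^ (1 / (d : ℝ)) • u) =
      (cube d 1).indicator (fun u => h (V ^ (1 / (d : ℝ)) • u)) u := by
    intro u
    by_cases hu : u ∈ cube d 1
    · rw [Set.indicator_of_mem hu, Set.indicator_of_mem ((smul_mem_cube_iff hV u).2 hu)]
    · rw [Set.indicator_of_notMem hu,
        Set.indicator_of_notMem (mt (smul_mem_cube_iff hV u).1 hu)]
  rw [integral_congr_ae (Eventually.of_forall hind)] at hs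
  rw [hs]
  field_simp

lemma eventually_add_smul_mem_cube (hd : 1 ≤ d) {u : Euc d} (hu : ∀ i, |u i| < 1 / 2)
    (x : Euc d) : ∀ᶠ V in atTop, x + V ^ (1 / (d : ℝ)) • u ∈ cube d V := by
  have hr : Tendsto (fun V : ℝ => V ^ (1 / (d : ℝ))) atTop atTop :=
    tendsto_rpow_atTop (by have : 0 < (d : ℝ) := by exact_mod_cast hd
                           positivity)
  simp only [cube, Set.mem_ofPred_eq, PiLp.add_apply, PiLp.smul_apply, smul_eq_mul]
  refine eventually_all.2 fun i => ?_
  filter_upwards [hr.eventually_ge_atTop 0,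
    hr.eventually_ge_atTop (|x i| / (1 / 2 - |u i|))] with V h0 h1
  have hpos : 0 < 1 / 2 - |u i| := by linarith [hu i]
  rw [div_le_iff₀ hpos] at h1
  refine (abs_add_le _ _).trans ?_
  rw [abs_mul, abs_of_nonneg h0]
  linarith

end cubes

section pressure

variable {d : ℕ} {e f α : Euc d → ℝ} {C : ℝ}

/-- Ratios of finite volume partition functions converge to the limit of the iterates. -/
lemma tendsto_gibbsRatio (he : IsProfile e) (hev : ∀ x, e (-x) = e x) (hf : IsProfile f)
    (hfi : Integrable f) (hfe : ∀ x, e x = 1 - f x) (hC : ∫ x, f x = C) (hCpos : 0 < C) {t : ℝ}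
    (ht : t ∈ Set.Ico 0 (Real.exp 1 / C)) {ρ : ℝ}
    (hρ : Tendsto (fun n => realRatioIter f t n α) atTop (nhds ρ)) {ι : Type*} {l : Filter ι}
    [l.IsCountablyGenerated] {A : ι → Euc d → ℝ} (hA : ∀ i, IsProfile (A i))
    (hAi : ∀ i, Integrable (A i)) (hlim : ∀ x, Tendsto (fun i => A i x) l (nhds (α x))) :
    Tendsto (fun i => gibbsRatio e t (A i)) l (nhds ρ) := by
  have hL0 : 0 ≤ t * C := mul_nonneg ht.1 hCpos.le
  obtain ⟨κ, hκ0, hκ1, hκ⟩ := exists_contraction_constant hL0 ((lt_div_iff₀ hCpos).1 ht.2)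
  rw [Metric.tendsto_nhds]
  intro ε hε
  have h0 : Tendsto (fun n : ℕ => (1 + t * C) * (κ ^ n * (t * C))) atTop (nhds 0) := by
    simpa using ((tendsto_pow_atTop_nhds_zero_of_lt_one hκ0 hκ1).mul_const (t * C)).const_mul
      (1 + t * C)
  obtain ⟨n, hn0, hnρ⟩ := ((h0.eventually_lt_const (show 0 < ε / 3 by positivity)).and
    ((tendsto_add_atTop_iff_nat 1).2 hρ |>.eventually
      (Metric.ball_mem_nhds ρ (show 0 < ε / 3 by positivity)))).exists
  have hn : Tendsto (fun i => realRatioIter f t (n + 1) (A i)) l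
      (nhds (realRatioIter f t (n + 1) α)) := by
    have := (Complex.continuous_re.tendsto _).comp (tendsto_ratioIter hf hfi t (n + 1) hA hlim)
    simpa [Function.comp_def, ratioIter_ofReal] using this
  filter_upwards [Metric.tendsto_nhds.1 hn (ε / 3) (by positivity)] with i hi
  have h1 := abs_gibbsRatio_sub_le he hev hf hfi hfe hC hCpos ht.1 hκ hκ0 n (hA i) (hAi i)
  rw [← Real.dist_eq] at h1
  change dist (realRatioIter f t (n + 1) α) ρ < ε / 3 at hnρ
  have h2 := dist_triangle4 (gibbsRatio e t (A i)) (realRatioIter f t (n + 1) (A i))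
    (realRatioIter f t (n + 1) α) ρ
  linarith

/-- The indicator of the cube of volume `V`, seen from its point `V ^ (1 / d) • u`. -/
def cubeProfile (d : ℕ) (V : ℝ) (u : Euc d) : Euc d → ℝ :=
  fun x => (cube d V).indicator (fun _ => 1) (x + V ^ (1 / (d : ℝ)) • u)

lemma measurable_indicator_cube (d : ℕ) (V : ℝ) :
    Measurable ((cube d V).indicator fun _ => (1 : ℝ)) :=
  measurable_const.indicator (measurableSet_cube d V)

lemma integrable_indicator_cube (d : ℕ) (V : ℝ) :
    Integrable ((cube d V).indicator fun _ => (1 : ℝ)) :=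
  (integrable_indicator_iff (measurableSet_cube d V)).2
    (integrableOn_const (by rw [volume_cube]; exact ENNReal.pow_ne_top ENNReal.ofReal_ne_top))

lemma isProfile_cubeProfile (V : ℝ) (u : Euc d) : IsProfile (cubeProfile d V u) := by
  refine ⟨(measurable_indicator_cube d V).comp (by fun_prop),
    fun x => Set.indicator_nonneg (fun _ _ => zero_le_one) _, fun x => ?_⟩
  exact Set.indicator_le_self' (fun _ _ => zero_le_one) _

lemma integrable_cubeProfile (V : ℝ) (u : Euc d) : Integrable (cubeProfile d V u) :=
  (integrable_indicator_cube d V).comp_add_right _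

lemma measurable_gibbsRatio_cubeProfile (he : Measurable e) (V : ℝ) :
    Measurable fun p : ℝ × Euc d => gibbsRatio e p.1 (cubeProfile d V p.2) := by
  refine measurable_gibbsRatio he measurable_fst
    (A := fun p : ℝ × Euc d => cubeProfile d V p.2) ?_
  exact (measurable_indicator_cube d V).comp
    (f := fun q : (ℝ × Euc d) × Euc d => q.2 + V ^ (1 / (d : ℝ)) • q.1.2) (by fun_prop)

lemma gibbsZ_zero (he : IsProfile e) : gibbsZ e (fun _ => 0) = 1 := by
  refine le_antisymm ?_ (one_le_gibbsZ he (integrable_zero _ _ _) fun _ => le_rfl)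
  simpa using (le_abs_self _).trans (gibbsZ_le_exp he (a := fun _ => 0) (integrable_zero _ _ _))

/-- The finite volume pressure as an integral of averaged ratios. -/
lemma inv_mul_log_gibbsZ_cube (hd : 1 ≤ d) (he : IsProfile e) (hev : ∀ x, e (-x) = e x)
    {lam : ℝ} (hlam : 0 ≤ lam) {V : ℝ} (hV : 0 < V) :
    V⁻¹ * Real.log (gibbsZ e fun x => lam * (cube d V).indicator (fun _ => 1) x) =
      ∫ t in (0 : ℝ)..lam, ∫ u in cube d 1, gibbsRatio e t (cubeProfile d V u) := by
  have h := log_gibbsZ_sub he hev (a := fun _ => 0) (integrable_zero _ _ _)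
    (integrable_indicator_cube d V) measurable_const (measurable_indicator_cube d V) hlam
    fun s hs x => by
      rw [zero_add]
      exact mul_nonneg hs.1 (Set.indicator_nonneg (fun _ _ => zero_le_one) _)
  simp only [zero_add, gibbsZ_zero he, Real.log_one, sub_zero] at h
  rw [h, ← intervalIntegral.integral_const_mul]
  refine intervalIntegral.integral_congr fun t _ => ?_
  have hw : ∀ w, (cube d V).indicator (fun _ => (1 : ℝ)) w *
      (gibbsZ e (fun x => (t * (cube d V).indicator (fun _ => 1) x) * e (w - x)) /
        gibbsZ e (fun x => t * (cube d V).indicator (fun _ => 1) x)) =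
      (cube d V).indicator (fun w => gibbsRatio e t
        fun x => (cube d V).indicator (fun _ => 1) (x + w)) w := by
    intro w
    rw [gibbsRatio_translate hev (fun x => t * (cube d V).indicator (fun _ => 1) x) w
      (lam := t) (α := fun x => (cube d V).indicator (fun _ => 1) (x + w)) fun x => rfl]
    by_cases hmem : w ∈ cube d V <;> simp [hmem]
  simp only [hw]
  rw [integral_indicator (measurableSet_cube d V), setIntegral_cube_eq hd hV,
    inv_mul_cancel_left₀ hV.ne']
  rfl

/-- The finite volume pressure converges to the primitive of the limit of the iterates. -/
lemma tendsto_inv_mul_log_gibbsZ_cube (hd : 1 ≤ d) (he : IsProfile e) (hev : ∀ x, e (-x) = e x)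
    (hf : IsProfile f) (hfi : Integrable f) (hfe : ∀ x, e x = 1 - f x) (hC : ∫ x, f x = C)
    (hCpos : 0 < C) {ρ : ℝ → ℝ} (hρ : ∀ t ∈ Set.Ico 0 (Real.exp 1 / C),
      Tendsto (fun n => realRatioIter f t n fun _ => 1) atTop (nhds (ρ t)))
    {lam : ℝ} (hlam : lam ∈ Set.Ico 0 (Real.exp 1 / C)) :
    Tendsto (fun V => V⁻¹ * Real.log (gibbsZ e fun x => lam * (cube d V).indicator (fun _ => 1) x))
      atTop (nhds (∫ t in (0 : ℝ)..lam, ρ t)) := by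
  have hvol : (volume : Measure (Euc d)) (cube d 1) = 1 := by simp [volume_cube]
  have hfin : IsFiniteMeasure ((volume : Measure (Euc d)).restrict (cube d 1)) :=
    ⟨by simp [hvol]⟩
  have hbd : ∀ t ∈ Set.Ioc 0 lam, ∀ V u, ‖gibbsRatio e t (cubeProfile d V u)‖ ≤ 1 := by
    intro t ht V u
    have := gibbsRatio_mem he hev ht.1.le (isProfile_cubeProfile V u) (integrable_cubeProfile V u)
    rw [Real.norm_eq_abs, abs_of_nonneg this.1]
    exact this.2
  have hm := measurable_gibbsRatio_cubeProfile (d := d) he.measurable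
  suffices h : Tendsto (fun V => ∫ t in (0 : ℝ)..lam, ∫ u in cube d 1,
      gibbsRatio e t (cubeProfile d V u)) atTop (nhds (∫ t in (0 : ℝ)..lam, ρ t)) by
    refine h.congr' ?_
    filter_upwards [eventually_gt_atTop 0] with V hV
    exact (inv_mul_log_gibbsZ_cube hd he hev hlam.1 hV).symm
  refine intervalIntegral.tendsto_integral_filter_of_dominated_convergence (fun _ => 1)
    (Eventually.of_forall fun V => ?_) (Eventually.of_forall fun V => ?_)
    intervalIntegrable_const ?_
  · exact (StronglyMeasurable.integral_prod_right
      (f := fun t u => gibbsRatio e t (cubeProfile d V u))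
      (hm V).stronglyMeasurable).aestronglyMeasurable
  · refine Eventually.of_forall fun t ht => ?_
    rw [Set.uIoc_of_le hlam.1] at ht
    have := norm_setIntegral_le_of_norm_le_const (μ := volume) (s := cube d 1) (C := 1)
      (by simp [hvol]) fun u _ => hbd t ht V u
    simpa [measureReal_def, hvol] using this
  · refine Eventually.of_forall fun t ht => ?_
    rw [Set.uIoc_of_le hlam.1] at ht
    have htI : t ∈ Set.Ico 0 (Real.exp 1 / C) := ⟨ht.1.le, ht.2.trans_lt hlam.2⟩
    have hconst : ∫ _ in cube d 1, ρ t = ρ t := by simp [measureReal_def, hvol]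
    rw [← hconst]
    refine tendsto_integral_filter_of_dominated_convergence (fun _ => 1)
      (Eventually.of_forall fun V => ((hm V).comp measurable_prodMk_left).aestronglyMeasurable)
      (Eventually.of_forall fun V => Eventually.of_forall fun u => hbd t ht V u)
      (integrable_const 1) ?_
    filter_upwards [ae_restrict_cube_one d] with u hu
    refine tendsto_gibbsRatio he hev hf hfi hfe hC hCpos htI (hρ t htI)
      (fun V => isProfile_cubeProfile V u) (fun V => integrable_cubeProfile V u) fun x => ?_
    refine tendsto_const_nhds.congr' ?_
    filter_upwards [eventually_add_smul_mem_cube hd hu x] with V hV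
    exact (Set.indicator_of_mem hV (fun _ => (1 : ℝ))).symm

end pressure

section potential

variable {d : ℕ}

lemma measurable_expNeg : Measurable expNeg :=
  Measurable.ite (measurableSet_singleton _) measurable_const (by fun_prop)

lemma isProfile_expNeg_comp {φ : Euc d → ENNReal} (hφ : Measurable φ) :
    IsProfile fun x => expNeg (φ x) := by
  refine ⟨measurable_expNeg.comp hφ, fun x => ?_, fun x => ?_⟩ <;>
  · unfold expNeg
    split_ifs
    · norm_num
    · first | exact (Real.exp_pos _).le | exact Real.exp_le_one_iff.2 (by simp)

lemma Zreal_eq_gibbsZ (φ : Euc d → ENNReal) {Λ : Set (Euc d)} (hΛ : MeasurableSet Λ) (lam : ℝ) :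
    Zreal φ Λ lam = gibbsZ (fun x => expNeg (φ x)) fun x => lam * Λ.indicator (fun _ => 1) x := by
  refine tsum_congr fun k => ?_
  have hind : ∀ x : Fin k → Euc d, (∏ i, lam * Λ.indicator (fun _ => (1 : ℝ)) (x i)) *
      gibbsWeight (fun x => expNeg (φ x)) k x =
      lam ^ k * (Set.univ.pi fun _ : Fin k => Λ).indicator (pairWeight φ k) x := by
    intro x
    rw [Finset.prod_mul_distrib, Finset.prod_const, Finset.card_univ, Fintype.card_fin, mul_assoc]
    congr 1
    by_cases hx : x ∈ Set.univ.pi fun _ : Fin k => Λ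
    · rw [Set.indicator_of_mem hx, Finset.prod_eq_one fun i _ =>
        Set.indicator_of_mem (hx i trivial) _, one_mul]
      rfl
    · rw [Set.indicator_of_notMem hx]
      obtain ⟨i, hi⟩ : ∃ i, x i ∉ Λ := by simpa [Set.mem_univ_pi] using hx
      rw [Finset.prod_eq_zero (Finset.mem_univ i) (Set.indicator_of_notMem hi _), zero_mul]
  simp only [gibbsTerm, hind]
  rw [integral_const_mul, integral_indicator (.univ_pi fun _ => hΛ)]
  ring

end potential

/-- Theorem 1: for a repulsive tempered potential the infinite volume pressure
extends to an analytic function on a complex neighborhood of `[0, e/C_φ)`. -/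
theorem pressure_analytic
    (d : ℕ) (hd : 1 ≤ d)
    (φ : Euc d → ENNReal) (hφmeas : Measurable φ)
    (hφsymm : ∀ x, φ (-x) = φ x)
    (hφtemp : Integrable (fun x : Euc d => 1 - expNeg (φ x)))
    (Cφ : ℝ) (hC : Cφ = ∫ x : Euc d, (1 - expNeg (φ x)))
    (hCpos : 0 < Cφ) :
    ∃ Ω : Set ℂ, IsOpen Ω ∧
      (∀ lam : ℝ, lam ∈ Set.Ico 0 (Real.exp 1 / Cφ) → (lam : ℂ) ∈ Ω) ∧
      ∃ p : ℂ → ℂ, AnalyticOnNhd ℂ p Ω ∧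
        ∀ lam : ℝ, lam ∈ Set.Ico 0 (Real.exp 1 / Cφ) →
          Tendsto (fun V : ℝ => ((V⁻¹ * Real.log (Zreal φ (cube d V) lam) : ℝ) : ℂ))
            atTop (nhds (p lam)) := by
  have he := isProfile_expNeg_comp hφmeas
  have hev : ∀ x, expNeg (φ (-x)) = expNeg (φ x) := fun x => by rw [hφsymm]
  have hem := he.measurable
  have hf : IsProfile fun x => 1 - expNeg (φ x) :=
    ⟨by fun_prop, fun x => sub_nonneg.2 (he.le_one x), fun x => sub_le_self _ (he.nonneg x)⟩
  obtain ⟨U, hU, hIU, R, hR, hlim⟩ := exists_differentiableOn_limit hf hφtemp hC.symm hCpos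
  obtain ⟨Ω, hΩ, hIΩ, p, hp, hpR⟩ := exists_analyticOnNhd_primitive hU hIU hR
  refine ⟨Ω, hΩ, hIΩ, p, hp, fun lam hlam => ?_⟩
  have hre : ∀ t ∈ Set.Ico 0 (Real.exp 1 / Cφ), Tendsto
      (fun n => realRatioIter (fun x => 1 - expNeg (φ x)) t n fun _ => 1) atTop
      (nhds (R t).re) := by
    intro t ht
    have := (Complex.continuous_re.tendsto _).comp (hlim t (hIU t ht))
    simpa [Function.comp_def, ratioIter_ofReal] using this
  have hRre : ∀ t ∈ Set.Ico 0 (Real.exp 1 / Cφ), ((R t).re : ℂ) = R t := by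
    intro t ht
    have h1 := (Complex.continuous_ofReal.tendsto _).comp (hre t ht)
    refine tendsto_nhds_unique h1 ((hlim t (hIU t ht)).congr fun n => ?_)
    exact ratioIter_ofReal _ t n _
  have hInt : p lam = ((∫ t in (0 : ℝ)..lam, (R t).re : ℝ) : ℂ) := by
    rw [hpR lam hlam, ← intervalIntegral.integral_ofReal]
    refine intervalIntegral.integral_congr fun t ht => ?_
    rw [Set.uIcc_of_le hlam.1] at ht
    exact (hRre t ⟨ht.1, ht.2.trans_lt hlam.2⟩).symm
  rw [hInt]
  simp only [Zreal_eq_gibbsZ φ (measurableSet_cube d _)]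
  exact (Complex.continuous_ofReal.tendsto _).comp
    (tendsto_inv_mul_log_gibbsZ_cube hd he hev hf hφtemp (fun x => (sub_sub_cancel _ _).symm)
      hC.symm hCpos hre hlam)

end
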